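/- Let T be a conformal Smale skew-product over the alphabet I = N* x N*, and for each s in F(T) let mu_{T,s} be the equilibrium measure (unique ergodic sigma-invariant Gibbs state) of the geometric potential psi_{T,s} on Sigma_I. Then the function s |-> delta_{T,s} := (P(psi_{T,s}) + s*chi_T(mu_{T,s})) / chi_T(mu_{T,s}) is real-analytic on the interior of the interval F(T). -/

import Mathlib

open MeasureTheory Filter Set Metric Topology

noncomputable section

/-- The left shift on one-sided sequences. -/
def shift1 {E : Type*} (ω : ℕ → E) : ℕ → E := fun n => ω (n + 1)

/-- The left shift on two-sided sequences. -/
def shift2 {E : Type*} (τ : ℤ → E) : ℤ → E := fun n => τ (n + 1)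

/-- Truncation `π₀` of a two-sided sequence to its nonnegative coordinates. -/
def truncZ {E : Type*} (τ : ℤ → E) : ℕ → E := fun n => τ (n : ℤ)

/-- Prepending a letter to a one-sided sequence. -/
def cons {E : Type*} (a : E) (ω : ℕ → E) : ℕ → E
  | 0 => a
  | n + 1 => ω n

/-- The cylinder `[τ₀ … τ_{n-1}]` in the two-sided shift space. -/
def cyl2 {E : Type*} (τ : ℤ → E) (n : ℕ) : Set (ℤ → E) :=
  {τ' | ∀ k : ℕ, k < n → τ' (k : ℤ) = τ (k : ℤ)}

/-- The cylinder `[ω]` of two-sided sequences agreeing with `ω` on all nonnegative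
coordinates. -/
def cylPlus {E : Type*} (ω : ℕ → E) : Set (ℤ → E) :=
  {τ | ∀ k : ℕ, τ (k : ℤ) = ω k}

/-- Birkhoff sums `S_n ψ` for the two-sided shift. -/
def birk {E : Type*} (ψ : (ℤ → E) → ℝ) (n : ℕ) (τ : ℤ → E) : ℝ :=
  ∑ j ∈ Finset.range n, ψ (shift2^[j] τ)

/-- `ψ` is Hölder continuous with respect to one of the metrics `d_β` on the two-sided
shift space. -/
def HolderShift {E : Type*} (ψ : (ℤ → E) → ℝ) : Prop :=
  ∃ β > (0 : ℝ), ∃ C > (0 : ℝ), ∀ (τ τ' : ℤ → E) (n : ℕ),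
    (∀ k : ℤ, |k| ≤ (n : ℤ) → τ k = τ' k) → |ψ τ - ψ τ'| ≤ C * Real.exp (-β * n)

/-- Summability of a potential on the two-sided shift space. -/
def SummablePot {E : Type*} (ψ : (ℤ → E) → ℝ) : Prop :=
  Summable fun e : E => Real.exp (sSup (ψ '' {τ : ℤ → E | τ 0 = e}))

/-- The sequence `(1/n) log Σ_{|w| = n} exp (sup S_n ψ |_{[w]})`, whose limit is the
topological pressure `P(ψ)`. -/
def pressureSeq {E : Type*} (ψ : (ℤ → E) → ℝ) (n : ℕ) : ℝ :=
  Real.log (∑' w : Fin n → E,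
    Real.exp (sSup (birk ψ n '' {τ : ℤ → E | ∀ j : Fin n, τ ((j : ℕ) : ℤ) = w j}))) / n

/-- `μ` is a Gibbs state of `ψ` with constant `P`. -/
def IsGibbs {E : Type*} [MeasurableSpace E] (ψ : (ℤ → E) → ℝ) (P : ℝ)
    (μ : Measure (ℤ → E)) : Prop :=
  ∃ C : ℝ, 1 ≤ C ∧ ∀ n : ℕ, 1 ≤ n → ∀ τ : ℤ → E,
    C⁻¹ * Real.exp (birk ψ n τ - n * P) ≤ (μ (cyl2 τ n)).toReal ∧
    (μ (cyl2 τ n)).toReal ≤ C * Real.exp (birk ψ n τ - n * P)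

/-- The shifted sequence `τ|_{-k}^∞`. -/
def tailShift {E : Type*} (τ : ℤ → E) (k : ℕ) : ℕ → E := fun m => τ ((m : ℤ) - (k : ℤ))

/-- The composition `T^n_τ = T_{τ|_{-1}^∞} ∘ ⋯ ∘ T_{τ|_{-n}^∞}`. -/
def Titer {E X : Type*} (T : (ℕ → E) → X → X) (τ : ℤ → E) : ℕ → X → X
  | 0 => id
  | n + 1 => Titer T τ n ∘ T (tailShift τ (n + 1))

/-- A conformal Smale skew-product endomorphism over the alphabet `E`:
fiberwise injective uniformly contracting conformal `C¹` maps of a compact set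
`Y ⊆ ℂ` (the closure of a bounded open set), extending to a bounded connected open
set `Y* ⊇ Y`, with bounded distortion, Hölder dependence of `log |T'|` along the
coding map `π̂₂`, the open set condition and the strong open set condition.
The coding map `π̂₂` (field `pi2`) is the map sending `τ` to the unique point of
`⋂_{n ≥ 1} closure (T^n_τ (Y))`. -/
structure SmaleSkew (E : Type*) [MeasurableSpace E] where
  Y : Set ℂ
  U : Set ℂ
  hUopen : IsOpen U
  hUbdd : Bornology.IsBounded U
  hUne : U.Nonempty
  hYU : Y = closure U
  Ystar : Set ℂ
  hYstar_open : IsOpen Ystar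
  hYstar_conn : IsConnected Ystar
  hYstar_bdd : Bornology.IsBounded Ystar
  hYYstar : Y ⊆ Ystar
  T : (ℕ → E) → ℂ → ℂ
  hTY : ∀ ω, MapsTo (T ω) Y Y
  hTYstar : ∀ ω, MapsTo (T ω) Ystar Ystar
  hTinj : ∀ ω, InjOn (T ω) Ystar
  hTdiff : ∀ ω, ∀ x ∈ Ystar, DifferentiableAt ℝ (T ω) x
  hTconf : ∀ ω, ∀ x ∈ Ystar, IsConformalMap (fderiv ℝ (T ω) x)
  hTC1 : ∀ ω, ContinuousOn (fun x => fderiv ℝ (T ω) x) Ystar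
  lam : ℝ
  hlam : 1 < lam
  hcontr : ∀ ω, ∀ y ∈ Ystar, ∀ z ∈ Ystar, dist (T ω y) (T ω z) ≤ lam⁻¹ * dist y z
  hdistortion : ∃ α > (0 : ℝ), ∃ H > (0 : ℝ), ∀ ω, ∀ y ∈ Ystar, ∀ z ∈ Ystar,
    |Real.log ‖fderiv ℝ (T ω) y‖ - Real.log ‖fderiv ℝ (T ω) z‖| ≤ H * ‖y - z‖ ^ α
  pi2 : (ℤ → E) → ℂ
  hpi2 : ∀ (τ : ℤ → E) (n : ℕ), 1 ≤ n → pi2 τ ∈ closure (Titer T τ n '' Y)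
  hpi2_meas : Measurable pi2
  hHolder : HolderShift fun τ => Real.log ‖fderiv ℝ (T (truncZ τ)) (pi2 τ)‖
  hOSC : ∀ (ω : ℕ → E) (a b : E), a ≠ b →
    (T (cons a ω) '' interior Y) ∩ (T (cons b ω) '' interior Y) = ∅
  hSOSC : ∃ δ : (ℕ → E) → ℝ, Measurable δ ∧ ∀ ω : ℕ → E, 0 < δ ω ∧
    ∃ x ∈ pi2 '' cylPlus ω, x ∈ Y ∧ δ ω < infDist x Yᶜ

/-- The fiber limit set `J_{T,ω} = π̂₂([ω])`. -/
def fiberJ {E : Type*} [MeasurableSpace E] (S : SmaleSkew E) (ω : ℕ → E) : Set ℂ :=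
  S.pi2 '' cylPlus ω

/-- The Lyapunov exponent `χ_T(μ) = -∫ log |T'_{η|₀^∞}(π̂₂ η)| dμ(η)`. -/
def lyap {E : Type*} [MeasurableSpace E] (S : SmaleSkew E) (μ : Measure (ℤ → E)) : ℝ :=
  -∫ τ, Real.log ‖fderiv ℝ (S.T (truncZ τ)) (S.pi2 τ)‖ ∂μ

/-- A measure `ν` on a metric space is exact dimensional with dimension `d` if
`log ν(B(x,r)) / log r → d` as `r → 0⁺`, for `ν`-a.e. `x`. -/
def ExactDimensional {X : Type*} [MetricSpace X] [MeasurableSpace X]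
    (ν : Measure X) (d : ℝ) : Prop :=
  ∀ᵐ x ∂ν, Tendsto (fun r : ℝ => Real.log (ν (ball x r)).toReal / Real.log r)
    (𝓝[>] (0 : ℝ)) (𝓝 d)

/-- The alphabet `I = ℕ* × ℕ*`. -/
abbrev Ialph : Type := ℕ+ × ℕ+

instance : MeasurableSpace ℕ+ := ⊤

instance : MeasurableSingletonClass ℕ+ := ⟨fun _ => MeasurableSpace.measurableSet_top⟩

/-- The geometric potential `ψ_{T,s}(η) = s log |T'_{η|₀^∞}(π̂₂ η)|`. -/
def geomPot {E : Type*} [MeasurableSpace E] (S : SmaleSkew E) (s : ℝ) :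
    (ℤ → E) → ℝ :=
  fun η => s * Real.log ‖fderiv ℝ (S.T (truncZ η)) (S.pi2 η)‖

/-- The interval `F(T)` of parameters `s ≥ 0` for which the geometric potential
`ψ_{T,s}` is summable. -/
def FT {E : Type*} [MeasurableSpace E] (S : SmaleSkew E) : Set ℝ :=
  {s : ℝ | 0 ≤ s ∧ Summable fun i : E =>
    sSup {x : ℝ | ∃ ω : ℕ → E, ∃ ξ ∈ fiberJ S (cons i ω),
      x = ‖fderiv ℝ (S.T (cons i ω)) ξ‖ ^ s}}

/-- A power series in the second variable whose coefficients are holomorphic in the first one and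
decay geometrically is continuously differentiable in both variables. -/
theorem contDiffAt_tsum_mul_pow {s y : ℂ} {δ γ C : ℝ} (hδ : 0 < δ) (hγ : 0 < γ)
    {a : ℕ → ℂ → ℂ} (ha : ∀ k, DifferentiableOn ℂ (a k) (ball s δ))
    (hb : ∀ k, ∀ z ∈ ball s δ, ‖a k z‖ ≤ C * γ ^ k) (hy : ‖y‖ < 1 / γ) :
    ContDiffAt ℂ 1 (fun p : ℂ × ℂ => ∑' k, a k p.1 * p.2 ^ (k + 1)) (s, y) := by
  obtain ⟨R, hyR, hR⟩ := exists_between hy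
  have hR0 : 0 < R := (norm_nonneg y).trans_lt hyR
  have hγR : γ * R < 1 := by rw [lt_div_iff₀ hγ] at hR; linarith
  have hγR0 : 0 < γ * R := mul_pos hγ hR0
  have hC : 0 ≤ C := by
    have := (norm_nonneg _).trans (hb 0 s (mem_ball_self hδ)); simpa using this
  set N : Set (ℂ × ℂ) := ball s (δ / 2) ×ˢ ball 0 R
  have hNo : IsOpen N := isOpen_ball.prod isOpen_ball
  have hNc : IsPreconnected N :=
    (convex_ball s (δ / 2)).isPreconnected.prod (convex_ball 0 R).isPreconnected
  have hsub : ∀ p ∈ N, p.1 ∈ ball s δ := fun p hp => ball_subset_ball (by linarith) hp.1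
  have hyN : (s, y) ∈ N := ⟨mem_ball_self (by linarith), by simpa using hyR⟩
  have hR' : ∀ p ∈ N, ‖p.2‖ ≤ R := fun p hp => by
    have := hp.2; rw [mem_ball_zero_iff] at this; exact this.le
  let f' : ℕ → ℂ × ℂ → ℂ × ℂ →L[ℂ] ℂ := fun k p =>
    a k p.1 • (((k + 1 : ℕ) * p.2 ^ k : ℂ) • ContinuousLinearMap.snd ℂ ℂ ℂ) +
      p.2 ^ (k + 1) • (deriv (a k) p.1 • ContinuousLinearMap.fst ℂ ℂ ℂ)
  let u : ℕ → ℝ := fun k =>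
    C * ((k : ℝ) ^ 1 * (γ * R) ^ k) + (C + C / (δ / 2) * R) * (γ * R) ^ k
  have hsum : Summable fun k : ℕ => (γ * R) ^ k := summable_geometric_of_lt_one hγR0.le hγR
  have hu : Summable u :=
    ((summable_pow_mul_geometric_of_norm_lt_one 1
      (by rwa [Real.norm_of_nonneg hγR0.le])).mul_left C).add (hsum.mul_left _)
  have hderiv : ∀ k, ∀ p ∈ N, HasFDerivAt (fun p : ℂ × ℂ => a k p.1 * p.2 ^ (k + 1)) (f' k p) p := by
    intro k p hp
    have h1 : HasFDerivAt (fun p : ℂ × ℂ => a k p.1)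
        (deriv (a k) p.1 • ContinuousLinearMap.fst ℂ ℂ ℂ) p :=
      (((ha k).differentiableAt (isOpen_ball.mem_nhds (hsub p hp))).hasDerivAt).comp_hasFDerivAt p
        hasFDerivAt_fst
    have h2 : HasFDerivAt (fun p : ℂ × ℂ => p.2 ^ (k + 1))
        (((k + 1 : ℕ) * p.2 ^ k : ℂ) • ContinuousLinearMap.snd ℂ ℂ ℂ) p :=
      (hasDerivAt_pow (k + 1) p.2).comp_hasFDerivAt p hasFDerivAt_snd
    exact h1.mul h2
  have hbound : ∀ k, ∀ p ∈ N, ‖f' k p‖ ≤ u k := by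
    intro k p hp
    have hd : ‖deriv (a k) p.1‖ ≤ C * γ ^ k / (δ / 2) := by
      have hcb : closedBall p.1 (δ / 4) ⊆ ball s δ := by
        intro w hw
        have h1 := hp.1
        rw [mem_ball] at h1 ⊢
        rw [mem_closedBall] at hw
        linarith [dist_triangle w p.1 s]
      have hbb : ball p.1 (δ / 2) ⊆ ball s δ := by
        intro w hw
        have h1 := hp.1
        rw [mem_ball] at h1 hw ⊢
        linarith [dist_triangle w p.1 s]
      have hle : ∀ r, 0 < r → r < δ / 2 → ‖deriv (a k) p.1‖ ≤ C * γ ^ k / r := by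
        intro r hr hr2
        refine Complex.norm_deriv_le_of_forall_mem_sphere_norm_le hr ?_ ?_
        · refine (DifferentiableOn.mono (ha k) ?_).diffContOnCl
          exact (closure_ball_subset_closedBall.trans
            (closedBall_subset_ball hr2)).trans hbb
        · intro z hz
          exact hb k z (hbb (closedBall_subset_ball hr2 (sphere_subset_closedBall hz)))
      have hlim : Tendsto (fun r : ℝ => C * γ ^ k / r) (𝓝[<] (δ / 2)) (𝓝 (C * γ ^ k / (δ / 2))) :=
        ((continuousAt_const.div continuousAt_id (by simp; positivity)).tendsto).mono_left
          nhdsWithin_le_nhds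
      refine ge_of_tendsto hlim ?_
      filter_upwards [Ioo_mem_nhdsLT (show (0 : ℝ) < δ / 2 by linarith)] with r hr
      exact hle r hr.1 hr.2
    have e1 : ‖a k p.1 • (((k + 1 : ℕ) * p.2 ^ k : ℂ) • ContinuousLinearMap.snd ℂ ℂ ℂ)‖
        ≤ (C * γ ^ k) * (((k : ℝ) + 1) * R ^ k * 1) := by
      rw [norm_smul, norm_smul, norm_mul, norm_pow, Complex.norm_natCast]
      push_cast
      gcongr
      · exact hb k _ (hsub p hp)
      · exact hR' p hp
      · exact ContinuousLinearMap.norm_snd_le ..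
    have e2 : ‖p.2 ^ (k + 1) • (deriv (a k) p.1 • ContinuousLinearMap.fst ℂ ℂ ℂ)‖
        ≤ R ^ (k + 1) * (C * γ ^ k / (δ / 2) * 1) := by
      rw [norm_smul, norm_smul, norm_pow]
      gcongr
      · exact hR' p hp
      · exact ContinuousLinearMap.norm_fst_le ..
    refine (norm_add_le _ _).trans ((add_le_add e1 e2).trans (le_of_eq ?_))
    simp only [u, mul_pow, pow_succ]
    ring
  have hs0 : Summable fun k => a k (s, y).1 * (s, y).2 ^ (k + 1) := by
    refine Summable.of_norm_bounded (hsum.mul_left (C * R)) fun k => ?_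
    rw [norm_mul, norm_pow]
    calc ‖a k s‖ * ‖y‖ ^ (k + 1) ≤ (C * γ ^ k) * R ^ (k + 1) := by
          gcongr; exact hb k s (mem_ball_self hδ)
      _ = C * R * (γ * R) ^ k := by rw [mul_pow, pow_succ]; ring
  rw [contDiffAt_one_iff]
  refine ⟨fun p => ∑' k, f' k p, N, hNo.mem_nhds hyN, ?_, ?_⟩
  · refine continuousOn_tsum (fun k => ?_) hu hbound
    have hc1 : ContinuousOn (fun p : ℂ × ℂ => a k p.1) N :=
      (ha k).continuousOn.comp continuousOn_fst hsub
    have hc2 : ContinuousOn (fun p : ℂ × ℂ => deriv (a k) p.1) N :=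
      ((ha k).deriv isOpen_ball).continuousOn.comp continuousOn_fst hsub
    have hc3 : ContinuousOn (fun p : ℂ × ℂ => p.2) N := continuousOn_snd
    exact (hc1.smul ((continuousOn_const.mul (hc3.pow k)).smul continuousOn_const)).add
      ((hc3.pow (k + 1)).smul (hc2.smul continuousOn_const))
  · intro p hp
    exact hasFDerivAt_tsum_of_isPreconnected hu hNo hNc hderiv hbound hyN hs0 hp

/-- The generating function of a renewal sequence. -/
theorem one_sub_tsum_mul_tsum_of_renewal {a : ℕ → ℂ} {b : ℕ → ℝ} {γ C r c₂ y : ℝ}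
    (hγ : 0 < γ) (ha : ∀ k, ‖a k‖ ≤ C * γ ^ k) (hγr : γ < r)
    (hb0 : ∀ n, 0 ≤ b n) (hb : ∀ n, b n ≤ c₂ * r ^ n)
    (hren : ∀ n, ((b (n + 1) : ℝ) : ℂ) = ∑ k ∈ Finset.range (n + 1), a k * b (n - k))
    (hy0 : 0 ≤ y) (hy : y * r < 1) :
    (1 - ∑' k, a k * (y : ℂ) ^ (k + 1)) * ((∑' n, b n * y ^ n : ℝ) : ℂ) = b 0 := by
  have hr : 0 < r := hγ.trans hγr
  have hyγ : y * γ < 1 := lt_of_le_of_lt (by gcongr) hy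
  have hbs : Summable fun n => b n * y ^ n := by
    refine Summable.of_nonneg_of_le (fun n => mul_nonneg (hb0 n) (by positivity)) (fun n => ?_)
      ((summable_geometric_of_lt_one (by positivity) hy).mul_left c₂)
    calc b n * y ^ n ≤ (c₂ * r ^ n) * y ^ n := by gcongr; exact hb n
      _ = c₂ * (y * r) ^ n := by rw [mul_pow]; ring
  have hg : Summable fun n => ‖((b n : ℂ)) * (y : ℂ) ^ n‖ := by
    refine hbs.congr fun n => ?_
    rw [norm_mul, norm_pow, Complex.norm_real, Complex.norm_real, Real.norm_of_nonneg (hb0 n),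
      Real.norm_of_nonneg hy0]
  have hf : Summable fun n => ‖a n * (y : ℂ) ^ n‖ := by
    refine Summable.of_nonneg_of_le (fun n => norm_nonneg _) (fun n => ?_)
      ((summable_geometric_of_lt_one (by positivity) hyγ).mul_left C)
    rw [norm_mul, norm_pow, Complex.norm_real, Real.norm_of_nonneg hy0]
    calc ‖a n‖ * y ^ n ≤ (C * γ ^ n) * y ^ n := by gcongr; exact ha n
      _ = C * (y * γ) ^ n := by rw [mul_pow]; ring
  have hprod := tsum_mul_tsum_eq_tsum_sum_range_of_summable_norm hf hg
  have hB : ((∑' n, b n * y ^ n : ℝ) : ℂ) = ∑' n, (b n : ℂ) * (y : ℂ) ^ n := by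
    rw [Complex.ofReal_tsum]; simp
  have hconv : ∀ n, ∑ k ∈ Finset.range (n + 1), a k * (y : ℂ) ^ k * (b (n - k) * (y : ℂ) ^ (n - k))
      = b (n + 1) * (y : ℂ) ^ n := by
    intro n
    rw [hren n, Finset.sum_mul]
    refine Finset.sum_congr rfl fun k hk => ?_
    have : k + (n - k) = n := by have := Finset.mem_range.1 hk; omega
    calc _ = a k * b (n - k) * ((y : ℂ) ^ k * (y : ℂ) ^ (n - k)) := by ring
      _ = _ := by rw [← pow_add, this]
  simp_rw [hconv] at hprod
  have hF : ∑' k, a k * (y : ℂ) ^ (k + 1) = y * ∑' k, a k * (y : ℂ) ^ k := by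
    rw [← tsum_mul_left]; congr 1; ext k; rw [pow_succ]; ring
  have h0 := hg.of_norm.tsum_eq_zero_add
  rw [hB, hF, sub_mul, one_mul, mul_assoc, hprod, h0, ← tsum_mul_left]
  simp only [pow_zero, mul_one, pow_succ]
  rw [add_sub_assoc, sub_eq_zero.2, add_zero]
  congr 1; ext n; ring

theorem norm_one_sub_tsum_of_renewal {a : ℕ → ℂ} {b : ℕ → ℝ} {γ C r c₁ c₂ y : ℝ}
    (hγ : 0 < γ) (ha : ∀ k, ‖a k‖ ≤ C * γ ^ k) (hγr : γ < r) (hc₁ : 0 < c₁)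
    (hb₁ : ∀ n, c₁ * r ^ n ≤ b n) (hb₂ : ∀ n, b n ≤ c₂ * r ^ n)
    (hren : ∀ n, ((b (n + 1) : ℝ) : ℂ) = ∑ k ∈ Finset.range (n + 1), a k * b (n - k))
    (hy0 : 0 ≤ y) (hy : y * r < 1) :
    c₁ / c₂ * (1 - y * r) ≤ ‖1 - ∑' k, a k * (y : ℂ) ^ (k + 1)‖ ∧
      ‖1 - ∑' k, a k * (y : ℂ) ^ (k + 1)‖ ≤ c₂ / c₁ * (1 - y * r) := by
  have hr : 0 < r := hγ.trans hγr
  have hb0 : ∀ n, 0 ≤ b n := fun n => le_trans (by positivity) (hb₁ n)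
  have h1 : c₁ ≤ b 0 := by simpa using hb₁ 0
  have h2 : b 0 ≤ c₂ := by simpa using hb₂ 0
  have hc₂ : 0 < c₂ := by linarith
  have hyr : 0 ≤ y * r := by positivity
  have hgeo := hasSum_geometric_of_lt_one hyr hy
  have key := congrArg norm
    (one_sub_tsum_mul_tsum_of_renewal hγ ha hγr hb0 hb₂ hren hy0 hy)
  have hpt : ∀ n, c₁ * (y * r) ^ n ≤ b n * y ^ n ∧ b n * y ^ n ≤ c₂ * (y * r) ^ n := by
    intro n
    have hyn : 0 ≤ y ^ n := by positivity
    constructor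
    · calc c₁ * (y * r) ^ n = (c₁ * r ^ n) * y ^ n := by rw [mul_pow]; ring
        _ ≤ _ := by gcongr; exact hb₁ n
    · calc b n * y ^ n ≤ (c₂ * r ^ n) * y ^ n := by gcongr; exact hb₂ n
        _ = _ := by rw [mul_pow]; ring
  have hs : Summable fun n => b n * y ^ n :=
    Summable.of_nonneg_of_le (fun n => mul_nonneg (hb0 n) (by positivity)) (fun n => (hpt n).2)
      (hgeo.summable.mul_left c₂)
  set B := ∑' n, b n * y ^ n
  have hB1 : c₁ / (1 - y * r) ≤ B := by
    have := (hgeo.mul_left c₁).summable.tsum_le_tsum (fun n => (hpt n).1) hs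
    rwa [(hgeo.mul_left c₁).tsum_eq, ← div_eq_mul_inv] at this
  have hB2 : B ≤ c₂ / (1 - y * r) := by
    have := hs.tsum_le_tsum (fun n => (hpt n).2) (hgeo.mul_left c₂).summable
    rwa [(hgeo.mul_left c₂).tsum_eq, ← div_eq_mul_inv] at this
  have hpos : 0 < 1 - y * r := by linarith
  have hBpos : 0 < B := lt_of_lt_of_le (by positivity) hB1
  rw [norm_mul, Complex.norm_real, Complex.norm_real, Real.norm_of_nonneg hBpos.le,
    Real.norm_of_nonneg (hb0 0)] at key
  set G := ‖1 - ∑' k, a k * (y : ℂ) ^ (k + 1)‖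
  have hG : G = b 0 / B := by rw [eq_div_iff hBpos.ne', key]
  rw [hG]
  constructor
  · rw [le_div_iff₀ hBpos]
    calc c₁ / c₂ * (1 - y * r) * B ≤ c₁ / c₂ * (1 - y * r) * (c₂ / (1 - y * r)) := by gcongr
      _ = c₁ := by field_simp
      _ ≤ b 0 := h1
  · rw [div_le_iff₀ hBpos]
    calc b 0 ≤ c₂ := h2
      _ = c₂ / c₁ * (1 - y * r) * (c₁ / (1 - y * r)) := by field_simp
      _ ≤ c₂ / c₁ * (1 - y * r) * B := by gcongr

/-- If a family of renewal equations has kernels which depend holomorphically on a parameter and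
decay at a rate strictly smaller than the growth rate `r` of the solutions, then `r` is an analytic
function of the parameter. -/
theorem analyticAt_of_renewal {s₀ δ γ C : ℝ} (hδ : 0 < δ) (hγ : 0 < γ) {a : ℕ → ℂ → ℂ}
    (ha : ∀ k, DifferentiableOn ℂ (a k) (ball (s₀ : ℂ) δ))
    (hC : ∀ k, ∀ z ∈ ball (s₀ : ℂ) δ, ‖a k z‖ ≤ C * γ ^ k)
    {b : ℝ → ℕ → ℝ} {r : ℝ → ℝ} (hr : ContinuousAt r s₀) (hγr : γ < r s₀)
    (hb : ∀ s ∈ ball s₀ δ, ∃ c₁ > 0, ∃ c₂, ∀ n, c₁ * r s ^ n ≤ b s n ∧ b s n ≤ c₂ * r s ^ n)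
    (hren : ∀ s ∈ ball s₀ δ, ∀ n,
      ((b s (n + 1) : ℝ) : ℂ) = ∑ k ∈ Finset.range (n + 1), a k s * b s (n - k)) :
    AnalyticAt ℝ r s₀ := by
  set F : ℂ × ℂ → ℂ := fun p => ∑' k, a k p.1 * p.2 ^ (k + 1) with hF
  have hmem : ∀ s ∈ ball s₀ δ, (s : ℂ) ∈ ball (s₀ : ℂ) δ := by
    intro s hs
    rw [mem_ball, Complex.dist_of_im_eq (by simp)]
    simpa using hs
  have hcd : ∀ s ∈ ball s₀ δ, ∀ y : ℂ, ‖y‖ < 1 / γ → ContDiffAt ℂ 1 F ((s : ℂ), y) := by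
    intro s hs y hy
    have hs' := hmem s hs
    rw [mem_ball] at hs'
    have hsub : ball (s : ℂ) (δ - dist (s : ℂ) s₀) ⊆ ball (s₀ : ℂ) δ :=
      ball_subset_ball' (by linarith)
    exact contDiffAt_tsum_mul_pow (sub_pos.2 hs') hγ (fun k => (ha k).mono hsub)
      (fun k z hz => hC k z (hsub hz)) hy
  have hyn : ∀ s, γ < r s → ‖((1 / r s : ℝ) : ℂ)‖ < 1 / γ := by
    intro s hs
    have : 0 < r s := hγ.trans hs
    rw [Complex.norm_real, Real.norm_of_nonneg (by positivity)]
    exact one_div_lt_one_div_of_lt hγ hs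
  have hlim : ∀ s, γ < r s → Tendsto (fun y : ℝ => 1 - y * r s) (𝓝[<] (1 / r s)) (𝓝 0) := by
    intro s hs
    have : 0 < r s := hγ.trans hs
    have h : ContinuousAt (fun y : ℝ => 1 - y * r s) (1 / r s) := by fun_prop
    have h' := h.tendsto.mono_left (nhdsWithin_le_nhds (s := Iio (1 / r s)))
    simpa [this.ne'] using h'
  have hIoo : ∀ s, γ < r s → ∀ᶠ y in 𝓝[<] (1 / r s), 0 ≤ y ∧ y * r s < 1 := by
    intro s hs
    have h0 : 0 < r s := hγ.trans hs
    filter_upwards [Ioo_mem_nhdsLT (show 0 < 1 / r s by positivity)] with y hy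
    exact ⟨hy.1.le, (lt_div_iff₀ h0).1 hy.2⟩
  have hzero : ∀ s ∈ ball s₀ δ, γ < r s → F ((s : ℂ), ((1 / r s : ℝ) : ℂ)) = 1 := by
    intro s hs hrs
    obtain ⟨c₁, hc₁, c₂, hc⟩ := hb s hs
    have hcont : Tendsto (fun y : ℝ => ‖1 - F ((s : ℂ), (y : ℂ))‖) (𝓝[<] (1 / r s))
        (𝓝 ‖1 - F ((s : ℂ), ((1 / r s : ℝ) : ℂ))‖) := by
      have h1 : ContinuousAt (fun y : ℝ => ((s : ℂ), (y : ℂ))) (1 / r s) := by fun_prop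
      have h2 : ContinuousAt (fun y : ℝ => F ((s : ℂ), (y : ℂ))) (1 / r s) :=
        ContinuousAt.comp (f := fun y : ℝ => ((s : ℂ), (y : ℂ))) (x := 1 / r s)
          (hcd s hs _ (hyn s hrs)).continuousAt h1
      exact (h2.tendsto.const_sub 1).norm.mono_left nhdsWithin_le_nhds
    have hup : Tendsto (fun y : ℝ => c₂ / c₁ * (1 - y * r s)) (𝓝[<] (1 / r s)) (𝓝 0) := by
      simpa using (hlim s hrs).const_mul (c₂ / c₁)
    have hle : ‖1 - F ((s : ℂ), ((1 / r s : ℝ) : ℂ))‖ ≤ 0 := by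
      refine le_of_tendsto_of_tendsto hcont hup ?_
      filter_upwards [hIoo s hrs] with y hy
      exact (norm_one_sub_tsum_of_renewal hγ (fun k => hC k s (hmem s hs)) hrs hc₁
        (fun n => (hc n).1) (fun n => (hc n).2) (hren s hs) hy.1 hy.2).2
    exact (sub_eq_zero.1 (norm_le_zero_iff.1 hle)).symm
  have hs₀ : s₀ ∈ ball s₀ δ := mem_ball_self hδ
  have hr₀ : 0 < r s₀ := hγ.trans hγr
  set u : ℂ × ℂ := ((s₀ : ℂ), ((1 / r s₀ : ℝ) : ℂ)) with hu
  have cdf : ContDiffAt ℂ 1 F u := hcd s₀ hs₀ _ (hyn s₀ hγr)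
  have hFu : F u = 1 := hzero s₀ hs₀ hγr
  have hne : fderiv ℂ F u (0, 1) ≠ 0 := by
    intro h0
    obtain ⟨c₁, hc₁, c₂, hc⟩ := hb s₀ hs₀
    have hc₂ : 0 < c₂ := by
      have h1 := (hc 0).1.trans (hc 0).2
      simp only [pow_zero, mul_one] at h1
      linarith
    have hline : HasDerivAt (fun y : ℝ => ((s₀ : ℂ), (y : ℂ))) ((0 : ℂ), (1 : ℂ)) (1 / r s₀) :=
      (hasDerivAt_const _ _).prodMk Complex.ofRealCLM.hasDerivAt
    have hd : HasDerivAt (fun y : ℝ => F ((s₀ : ℂ), (y : ℂ))) 0 (1 / r s₀) := by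
      have h1 : HasFDerivAt F ((fderiv ℂ F u).restrictScalars ℝ)
          ((fun y : ℝ => ((s₀ : ℂ), (y : ℂ))) (1 / r s₀)) :=
        (cdf.differentiableAt one_ne_zero).hasFDerivAt.restrictScalars ℝ
      have h2 := h1.comp_hasDerivAt _ hline
      rwa [ContinuousLinearMap.coe_restrictScalars', h0] at h2
    have hlo := hasDerivAt_iff_isLittleO.1 hd
    have hlo2 := (hlo.def (show 0 < c₁ / c₂ * r s₀ / 2 by positivity)).filter_mono
      (nhdsWithin_le_nhds (s := Iio (1 / r s₀)))
    obtain ⟨y, hy1, hy2, hy3⟩ := (hlo2.and ((hIoo s₀ hγr).and self_mem_nhdsWithin)).exists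
    have hlow := (norm_one_sub_tsum_of_renewal hγ (fun k => hC k s₀ (hmem s₀ hs₀)) hγr hc₁
        (fun n => (hc n).1) (fun n => (hc n).2) (hren s₀ hs₀) hy2.1 hy2.2).1
    have hy3' : y < 1 / r s₀ := hy3
    simp only [smul_zero, sub_zero] at hy1
    rw [show F ((s₀ : ℂ), ((1 / r s₀ : ℝ) : ℂ)) = 1 from hFu, norm_sub_rev,
      Real.norm_of_nonpos (by linarith)] at hy1
    have e : c₁ / c₂ * r s₀ / 2 * -(y - 1 / r s₀) = (c₁ / c₂ * (1 - y * r s₀)) / 2 := by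
      field_simp; ring
    rw [e] at hy1
    have hp : 0 < c₁ / c₂ * (1 - y * r s₀) := mul_pos (by positivity) (by linarith [hy2.2])
    have hlow' : c₁ / c₂ * (1 - y * r s₀) ≤ ‖1 - F ((s₀ : ℂ), (y : ℂ))‖ := hlow
    linarith
  have hinv : (fderiv ℂ F u ∘L .inr ℂ ℂ ℂ).IsInvertible := by
    refine ⟨ContinuousLinearEquiv.unitsEquivAut ℂ (Units.mk0 _ hne), ?_⟩
    ext
    simp
  set ψ := cdf.implicitFunction one_ne_zero hinv
  have hψ : AnalyticAt ℂ ψ (s₀ : ℂ) := by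
    rw [Complex.analyticAt_iff_eventually_differentiableAt]
    have h := (cdf.contDiffAt_implicitFunction one_ne_zero hinv).eventually (by simp)
    exact h.mono fun z hz => hz.differentiableAt one_ne_zero
  have hev : ∀ᶠ s in 𝓝 s₀, r s = (ψ (s : ℂ)).re⁻¹ := by
    have h1 := cdf.eventually_apply_eq_iff_implicitFunction one_ne_zero hinv
    have h2 : ContinuousAt (fun s : ℝ => ((s : ℂ), ((1 / r s : ℝ) : ℂ))) s₀ :=
      Complex.continuous_ofReal.continuousAt.prodMk
        (Complex.continuous_ofReal.continuousAt.comp (continuousAt_const.div hr hr₀.ne'))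
    filter_upwards [h2.eventually h1, hr.eventually (lt_mem_nhds hγr), ball_mem_nhds s₀ hδ]
      with s hs hrs hsδ
    have h3 := hs.1 (by rw [hzero s hsδ hrs, hFu])
    change ψ (s : ℂ) = _ at h3
    rw [h3]
    simp
  have hψr : AnalyticAt ℝ (fun s : ℝ => (ψ (s : ℂ)).re) s₀ := by
    have h1 : AnalyticAt ℝ (fun s : ℝ => (s : ℂ)) s₀ := Complex.ofRealCLM.analyticAt s₀
    have h2 : AnalyticAt ℝ (fun s : ℝ => ψ (s : ℂ)) s₀ :=
      AnalyticAt.comp (g := ψ) (f := fun s : ℝ => (s : ℂ)) hψ.restrictScalars h1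
    exact (Complex.reCLM.analyticAt _).comp h2
  have hψ0 : (ψ (s₀ : ℂ)).re ≠ 0 := by
    have h := hev.self_of_nhds
    intro h0
    rw [h0, inv_zero] at h
    exact hr₀.ne' h
  exact (hψr.inv hψ0).congr (hev.mono fun s hs => hs.symm)

/-- Existence of a metric gauge for which a Markov kernel on sequences, whose transition
probabilities have logarithmic oscillation at most `K * κ ^ N`, contracts in one step. -/
theorem exists_gauge {κ K : ℝ} (hκ0 : 0 < κ) (hκ1 : κ < 1) (hK : 0 ≤ K) :
    ∃ (D : ℕ → ℝ) (γ c : ℝ), 0 < γ ∧ γ < 1 ∧ 0 < c ∧ (∀ N, 0 < D N) ∧ (∀ N, D N ≤ 1) ∧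
      (∀ N, D (N + 1) ≤ D N) ∧ (∀ N, κ ^ N ≤ c * D N) ∧
      ∀ N, 1 - Real.exp (-(K * κ ^ N)) * (1 - D (N + 1)) ≤ γ * D N := by
  set η := (1 + κ) / 2 with hη
  have hη0 : 0 < η := by linarith
  have hη1 : η < 1 := by linarith
  have hκη : κ ≤ η := by linarith
  set m := Real.exp (-K) with hm
  have hm0 : 0 < m := Real.exp_pos _
  have hm1 : m ≤ 1 := Real.exp_le_one_iff.2 (by linarith)
  have hM : 1 ≤ 2 / m := by rw [le_div_iff₀ hm0]; linarith
  obtain ⟨N₀, hN₀⟩ : ∃ N₀ : ℕ, K * κ ^ N₀ ≤ (1 - η) / 4 := by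
    have h := (tendsto_pow_atTop_nhds_zero_of_lt_one hκ0.le hκ1).const_mul K
    rw [mul_zero] at h
    obtain ⟨N, hN⟩ := (h.eventually (gt_mem_nhds (show 0 < (1 - η) / 4 by linarith))).exists
    exact ⟨N, hN.le⟩
  set δ := (1 / (2 / m) ^ N₀) / 2 with hδ
  have hMpos : ∀ N : ℕ, 0 < (2 / m) ^ N := fun N => by positivity
  have hδ0 : 0 < δ := by have := hMpos N₀; positivity
  have hδM : δ * (2 / m) ^ N₀ = 1 / 2 := by
    rw [hδ]; have := (hMpos N₀).ne'; field_simp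
  set E : ℕ → ℝ := fun N => δ * ((2 / m) ^ N - 1) with hE
  have hE0 : ∀ N, 0 ≤ E N := fun N => mul_nonneg hδ0.le (by linarith [one_le_pow₀ hM (n := N)])
  have hE1 : ∀ N, N ≤ N₀ → E N ≤ 1 / 2 := by
    intro N hN
    have h1 : (2 / m) ^ N ≤ (2 / m) ^ N₀ := pow_le_pow_right₀ hM hN
    calc E N ≤ δ * (2 / m) ^ N₀ := by simp only [hE]; gcongr; linarith
      _ = 1 / 2 := hδM
  set D : ℕ → ℝ := fun N => η ^ (N - N₀) * (1 - E (min N N₀)) with hD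
  have hηp : ∀ n, 0 < η ^ n := fun n => by positivity
  have hηp1 : ∀ n, η ^ n ≤ 1 := fun n => pow_le_one₀ hη0.le hη1.le
  have hDlow : ∀ N, η ^ (N - N₀) / 2 ≤ D N := by
    intro N
    have := hE1 (min N N₀) (min_le_right _ _)
    simp only [hD]
    nlinarith [hηp (N - N₀)]
  have hD0 : ∀ N, 0 < D N := fun N => lt_of_lt_of_le (by have := hηp (N - N₀); positivity) (hDlow N)
  have hD1 : ∀ N, D N ≤ 1 := by
    intro N
    have h1 := hE0 (min N N₀)
    have h2 := hE1 (min N N₀) (min_le_right _ _)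
    simp only [hD]
    nlinarith [hηp (N - N₀), hηp1 (N - N₀)]
  have hγ1 : max ((1 + η) / 2) (1 - δ) < 1 := max_lt (by linarith) (by linarith)
  have hmain : ∀ N, 1 - Real.exp (-(K * κ ^ N)) * (1 - D (N + 1)) ≤
      max ((1 + η) / 2) (1 - δ) * D N := by
    intro N
    set μ := Real.exp (-(K * κ ^ N)) with hμ
    have hμ1 : μ ≤ 1 := Real.exp_le_one_iff.2 (by
      have := mul_nonneg hK (pow_pos hκ0 N).le; linarith)
    rcases lt_or_ge N N₀ with hN | hN
    · have e1 : D N = 1 - E N := by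
        simp only [hD]; rw [Nat.sub_eq_zero_of_le hN.le, min_eq_left hN.le]; simp
      have e2 : D (N + 1) = 1 - E (N + 1) := by
        simp only [hD]; rw [Nat.sub_eq_zero_of_le hN, min_eq_left hN]; simp
      have hμm : m ≤ μ := by
        apply Real.exp_le_exp.2
        have := mul_le_of_le_one_right hK (pow_le_one₀ hκ0.le hκ1.le (n := N))
        linarith
      have h3 : m * E (N + 1) ≤ μ * E (N + 1) := by gcongr; exact hE0 _
      have h4 : m * E (N + 1) = 2 * (δ * (2 / m) ^ N) - δ * m := by
        simp only [hE, pow_succ]; field_simp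
      have h5 : (1 - δ) * D N ≤ max ((1 + η) / 2) (1 - δ) * D N := by
        gcongr
        · exact (hD0 N).le
        · exact le_max_right _ _
      have h6 : E N = δ * (2 / m) ^ N - δ := by simp only [hE]; ring
      have h7 : δ ≤ δ * (2 / m) ^ N := le_mul_of_one_le_right hδ0.le (one_le_pow₀ hM)
      have h8 : 0 ≤ δ * E N := mul_nonneg hδ0.le (hE0 N)
      have h9 : δ * m ≤ δ := mul_le_of_le_one_right hδ0.le hm1
      rw [e2]
      rw [e1] at h5 ⊢
      nlinarith
    · have e2 : D (N + 1) = η * D N := by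
        simp only [hD]; rw [Nat.succ_sub hN, min_eq_right hN, min_eq_right (by omega), pow_succ]
        ring
      have hμK : 1 - K * κ ^ N ≤ μ := by
        have := Real.add_one_le_exp (-(K * κ ^ N)); linarith
      have h1 : K * κ ^ N ≤ (1 - η) / 2 * D N := by
        have e3 : κ ^ N = κ ^ N₀ * κ ^ (N - N₀) := by rw [← pow_add]; congr 1; omega
        calc K * κ ^ N = K * κ ^ N₀ * κ ^ (N - N₀) := by rw [e3]; ring
          _ ≤ (1 - η) / 4 * η ^ (N - N₀) := by gcongr
          _ = (1 - η) / 2 * (η ^ (N - N₀) / 2) := by ring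
          _ ≤ _ := mul_le_mul_of_nonneg_left (hDlow N) (by linarith)
      have h5 : (1 + η) / 2 * D N ≤ max ((1 + η) / 2) (1 - δ) * D N := by
        gcongr
        · exact (hD0 N).le
        · exact le_max_left _ _
      have h6 : 0 < η * D N := mul_pos hη0 (hD0 N)
      have h7 : 0 ≤ K * κ ^ N := mul_nonneg hK (pow_pos hκ0 N).le
      have h8 : D (N + 1) ≤ 1 := hD1 _
      have h9 : (1 - μ) * (1 - D (N + 1)) ≤ K * κ ^ N * 1 := by
        gcongr
        · linarith
        · linarith [hD0 (N + 1)]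
      rw [e2] at *
      nlinarith
  refine ⟨D, max ((1 + η) / 2) (1 - δ), 2, lt_max_of_lt_left (by linarith), hγ1, two_pos, hD0, hD1,
    ?_, ?_, hmain⟩
  · intro N
    have h1 := hmain N
    have h2 : max ((1 + η) / 2) (1 - δ) * D N ≤ 1 * D N := by
      gcongr
      exact (hD0 N).le
    have h3 : Real.exp (-(K * κ ^ N)) ≤ 1 := Real.exp_le_one_iff.2 (by
      have := mul_nonneg hK (pow_pos hκ0 N).le; linarith)
    have h4 := Real.exp_pos (-(K * κ ^ N))
    by_contra! hcon
    nlinarith [hD1 N, hD1 (N + 1)]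
  · intro N
    calc κ ^ N ≤ η ^ N := by gcongr
      _ ≤ η ^ (N - N₀) := pow_le_pow_of_le_one hη0.le hη1.le (Nat.sub_le _ _)
      _ ≤ 2 * D N := by linarith [hDlow N]

/-- Coupling estimate for two sub-probability weights with comparable masses. -/
theorem tsum_mul_sub_tsum_mul_le {E : Type*} {p q f g : E → ℝ} {m d l u A : ℝ}
    (hp : ∀ a, 0 ≤ p a) (hq : ∀ a, 0 ≤ q a) (hps : Summable p) (hqs : Summable q)
    (hp1 : ∑' a, p a ≤ 1) (hq1 : ∑' a, q a ≤ 1) (hm0 : 0 ≤ m) (hm1 : m ≤ 1)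
    (hpq : ∀ a, m * p a ≤ q a) (hqp : ∀ a, m * q a ≤ p a) (hd0 : 0 ≤ d) (hd : d ≤ 1) (hl : l ≤ 0)
    (hu : 0 ≤ u) (hA : u - l ≤ A) (hfl : ∀ a, l ≤ f a) (hfu : ∀ a, f a ≤ u)
    (hgl : ∀ a, l ≤ g a) (hgu : ∀ a, g a ≤ u) (hfg : ∀ a, f a - g a ≤ A * d) :
    ∑' a, p a * f a - ∑' a, q a * g a ≤ A * (1 - m * (1 - d)) := by
  have hA0 : 0 ≤ A := by linarith
  set w : E → ℝ := fun a => min (p a) (q a)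
  have hw0 : ∀ a, 0 ≤ w a := fun a => le_min (hp a) (hq a)
  have hws : Summable w := Summable.of_nonneg_of_le hw0 (fun a => min_le_left _ _) hps
  have hbd : ∀ {r h : E → ℝ}, (∀ a, 0 ≤ r a) → Summable r → (∀ a, l ≤ h a) → (∀ a, h a ≤ u) →
      Summable fun a => r a * h a := by
    intro r h hr hrs h1 h2
    refine Summable.of_norm_bounded (hrs.mul_right A) fun a => ?_
    rw [norm_mul, Real.norm_of_nonneg (hr a)]
    refine mul_le_mul_of_nonneg_left ?_ (hr a)
    rw [Real.norm_eq_abs, abs_le]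
    constructor <;> linarith [h1 a, h2 a]
  have hfs := hbd hp hps hfl hfu
  have hgs := hbd hq hqs hgl hgu
  set Q := ∑' a, w a
  set Sp := ∑' a, p a
  set Sq := ∑' a, q a
  have hQp : Q ≤ Sp := hws.tsum_le_tsum (fun a => min_le_left _ _) hps
  have hQq : Q ≤ Sq := hws.tsum_le_tsum (fun a => min_le_right _ _) hqs
  have hmp : m * Sp ≤ Q := by
    rw [← tsum_mul_left]
    exact (hps.mul_left m).tsum_le_tsum
      (fun a => le_min (mul_le_of_le_one_left (hp a) hm1) (hpq a)) hws
  have hmq : m * Sq ≤ Q := by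
    rw [← tsum_mul_left]
    exact (hqs.mul_left m).tsum_le_tsum
      (fun a => le_min (hqp a) (mul_le_of_le_one_left (hq a) hm1)) hws
  have hle : ∑' a, p a * f a - ∑' a, q a * g a ≤ Q * (A * d) + (Sp - Q) * u - (Sq - Q) * l := by
    rw [← hfs.tsum_sub hgs]
    have hR : HasSum (fun a => w a * (A * d) + (p a - w a) * u - (q a - w a) * l)
        (Q * (A * d) + (Sp - Q) * u - (Sq - Q) * l) :=
      ((hws.hasSum.mul_right _).add ((hps.hasSum.sub hws.hasSum).mul_right _)).sub
        ((hqs.hasSum.sub hws.hasSum).mul_right _)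
    rw [← hR.tsum_eq]
    refine (hfs.sub hgs).tsum_le_tsum (fun a => ?_) hR.summable
    have h1 : w a * (f a - g a) ≤ w a * (A * d) := mul_le_mul_of_nonneg_left (hfg a) (hw0 a)
    have h2 : (p a - w a) * f a ≤ (p a - w a) * u :=
      mul_le_mul_of_nonneg_left (hfu a) (sub_nonneg.2 (min_le_left _ _))
    have h3 : (q a - w a) * l ≤ (q a - w a) * g a :=
      mul_le_mul_of_nonneg_left (hgl a) (sub_nonneg.2 (min_le_right _ _))
    linarith
  refine hle.trans ?_
  rcases le_total Sp Sq with hS | hS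
  · have h1 : (Sp - Q) * u ≤ (Sq - Q) * u := by gcongr
    have h2 : (Sq - Q) * (u - l) ≤ (Sq - Q) * A := by gcongr
    have h3 : m * Sq * (1 - d) ≤ Q * (1 - d) := by gcongr
    have h4 : Sq * (1 - m * (1 - d)) ≤ 1 * (1 - m * (1 - d)) := by
      gcongr; nlinarith
    have h5 : A * (Q * d + Sq - Q) ≤ A * (1 - m * (1 - d)) :=
      mul_le_mul_of_nonneg_left (by linarith) hA0
    linarith
  · have h1 : (Sq - Q) * (-l) ≤ (Sp - Q) * (-l) := by gcongr; linarith
    have h2 : (Sp - Q) * (u - l) ≤ (Sp - Q) * A := by gcongr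
    have h3 : m * Sp * (1 - d) ≤ Q * (1 - d) := by gcongr
    have h4 : Sp * (1 - m * (1 - d)) ≤ 1 * (1 - m * (1 - d)) := by
      gcongr; nlinarith
    have h5 : A * (Q * d + Sp - Q) ≤ A * (1 - m * (1 - d)) :=
      mul_le_mul_of_nonneg_left (by linarith) hA0
    linarith

theorem norm_tsum_mul_sub_tsum_mul_le {E X : Type*} {p q : E → ℝ} {x y : E → X} {f : X → ℂ}
    {o : X} {m d A : ℝ} (hp : ∀ a, 0 ≤ p a) (hq : ∀ a, 0 ≤ q a) (hps : Summable p)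
    (hqs : Summable q) (hp1 : ∑' a, p a ≤ 1) (hq1 : ∑' a, q a ≤ 1) (hm0 : 0 ≤ m) (hm1 : m ≤ 1)
    (hpq : ∀ a, m * p a ≤ q a) (hqp : ∀ a, m * q a ≤ p a) (hd0 : 0 ≤ d) (hd : d ≤ 1)
    (ho : f o = 0) (hA : ∀ s t, ‖f s - f t‖ ≤ A) (hxy : ∀ a, ‖f (x a) - f (y a)‖ ≤ A * d) :
    ‖∑' a, (p a : ℂ) * f (x a) - ∑' a, (q a : ℂ) * f (y a)‖ ≤ A * (1 - m * (1 - d)) := by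
  have hfA : ∀ s, ‖f s‖ ≤ A := fun s => by simpa [ho] using hA s o
  have hsum : ∀ {r : E → ℝ} {t : E → X}, (∀ a, 0 ≤ r a) → Summable r →
      Summable fun a => (r a : ℂ) * f (t a) := by
    intro r t hr hrs
    refine Summable.of_norm_bounded (hrs.mul_right A) fun a => ?_
    rw [norm_mul, Complex.norm_real, Real.norm_of_nonneg (hr a)]
    exact mul_le_mul_of_nonneg_left (hfA _) (hr a)
  set v := ∑' a, (p a : ℂ) * f (x a) - ∑' a, (q a : ℂ) * f (y a) with hv
  obtain ⟨c, hc1, hcv⟩ : ∃ c : ℂ, ‖c‖ ≤ 1 ∧ (c * v).re = ‖v‖ := by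
    by_cases h0 : v = 0
    · exact ⟨0, by simp, by simp [h0]⟩
    · have h1 : (‖v‖ : ℝ) ≠ 0 := norm_ne_zero_iff.2 h0
      refine ⟨(starRingEnd ℂ v) / (‖v‖ : ℂ), ?_, ?_⟩
      · rw [norm_div, RCLike.norm_conj, Complex.norm_real, norm_norm, div_self h1]
      · rw [div_mul_eq_mul_div, mul_comm, Complex.mul_conj, Complex.normSq_eq_norm_sq,
          ← Complex.ofReal_div, Complex.ofReal_re]
        field_simp
  set F : X → ℝ := fun s => (c * f s).re
  have hFd : ∀ s t, F s - F t ≤ ‖f s - f t‖ := by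
    intro s t
    calc F s - F t = (c * (f s - f t)).re := by simp only [F]; rw [mul_sub, Complex.sub_re]
      _ ≤ ‖c * (f s - f t)‖ := Complex.re_le_norm _
      _ ≤ 1 * ‖f s - f t‖ := by rw [norm_mul]; gcongr
      _ = _ := one_mul _
  have hFA : ∀ s t, F s - F t ≤ A := fun s t => (hFd s t).trans (hA s t)
  have hFo : F o = 0 := by simp [F, ho]
  have : Nonempty X := ⟨o⟩
  have hbu : BddAbove (range F) := ⟨A, by rintro _ ⟨s, rfl⟩; linarith [hFA s o]⟩
  have hbl : BddBelow (range F) := ⟨-A, by rintro _ ⟨s, rfl⟩; linarith [hFA o s]⟩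
  have hre : ∀ {r : E → ℝ} {t : E → X}, (∀ a, 0 ≤ r a) → Summable r →
      (c * ∑' a, (r a : ℂ) * f (t a)).re = ∑' a, r a * F (t a) := by
    intro r t hr hrs
    rw [← tsum_mul_left, Complex.re_tsum ((hsum hr hrs).mul_left c)]
    refine tsum_congr fun a => ?_
    rw [mul_left_comm, Complex.re_ofReal_mul]
  rw [← hcv, hv, mul_sub, Complex.sub_re, hre hp hps, hre hq hqs]
  refine tsum_mul_sub_tsum_mul_le (l := ⨅ s, F s) (u := ⨆ s, F s) hp hq hps hqs hp1 hq1 hm0 hm1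
    hpq hqp hd0 hd ?_ ?_ ?_ (fun a => ciInf_le hbl _) (fun a => le_ciSup hbu _)
    (fun a => ciInf_le hbl _) (fun a => le_ciSup hbu _) fun a => (hFd _ _).trans (hxy a)
  · rw [← hFo]; exact ciInf_le hbl o
  · rw [← hFo]; exact le_ciSup hbu o
  · rw [sub_le_iff_le_add]
    refine ciSup_le fun s => ?_
    rw [← sub_le_iff_le_add']
    exact le_ciInf fun t => by linarith [hFA s t]

/-- Two one-sided sequences agree on their first `N` coordinates. -/
def Agree {E : Type*} (N : ℕ) (ω ω' : ℕ → E) : Prop := ∀ k < N, ω k = ω' k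

theorem Agree.cons {E : Type*} {N : ℕ} {ω ω' : ℕ → E} (h : Agree N ω ω') (a : E) :
    Agree (N + 1) (cons a ω) (cons a ω')
  | 0, _ => rfl
  | k + 1, hk => h k (by omega)

theorem Agree.symm {E : Type*} {N : ℕ} {ω ω' : ℕ → E} (h : Agree N ω ω') : Agree N ω' ω :=
  fun k hk => (h k hk).symm

/-- A sub-Markov kernel `p` on one-sided sequences with Hölder log-weights, together with a Hölder
potential `φ` all of whose exponential moments of order at most `2 * δ` are dominated by `W`. -/
structure SubMarkov {E : Type*} (p : E → (ℕ → E) → ℝ) (φ : (ℕ → E) → ℝ) (W : E → ℝ)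
    (K V κ δ : ℝ) : Prop where
  K_nonneg : 0 ≤ K
  V_nonneg : 0 ≤ V
  κ_pos : 0 < κ
  κ_lt : κ < 1
  δ_pos : 0 < δ
  nonneg : ∀ a ω, 0 ≤ p a ω
  tsum_le : ∀ ω, ∑' a, p a ω ≤ 1
  holder : ∀ a N ω ω', Agree N ω ω' → p a ω ≤ Real.exp (K * κ ^ N) * p a ω'
  pot : ∀ N ω ω', Agree (N + 1) ω ω' → |φ ω - φ ω'| ≤ V * κ ^ N
  summable : Summable W
  le : ∀ a ω, p a ω * Real.exp (2 * δ * |φ (cons a ω)|) ≤ W a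

/-- The conditions on the gauge produced by `exists_gauge`. -/
structure IsGauge (D : ℕ → ℝ) (γ c K κ : ℝ) : Prop where
  γ_pos : 0 < γ
  γ_lt : γ < 1
  c_pos : 0 < c
  pos : ∀ N, 0 < D N
  le_one : ∀ N, D N ≤ 1
  anti : ∀ N, D (N + 1) ≤ D N
  pow_le : ∀ N, κ ^ N ≤ c * D N
  contract : ∀ N, 1 - Real.exp (-(K * κ ^ N)) * (1 - D (N + 1)) ≤ γ * D N

/-- The transfer operator of the kernel `p` tilted by `exp (w * φ)`. -/
def tilt {E : Type*} (p : E → (ℕ → E) → ℝ) (φ : (ℕ → E) → ℝ) (w : ℂ) (f : (ℕ → E) → ℂ)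
    (ω : ℕ → E) : ℂ :=
  ∑' a, (p a ω : ℂ) * Complex.exp (w * φ (cons a ω)) * f (cons a ω)

/-- The functions obtained by iterating `tilt` and subtracting the value at `o` at each step. -/
def tiltSeq {E : Type*} (p : E → (ℕ → E) → ℝ) (φ : (ℕ → E) → ℝ) (o : ℕ → E) (w : ℂ) :
    ℕ → (ℕ → E) → ℂ
  | 0 => fun _ => 1
  | k + 1 => fun ω => tilt p φ w (tiltSeq p φ o w k) ω - tilt p φ w (tiltSeq p φ o w k) o

theorem norm_exp_sub_one_le_mul_exp (u : ℂ) : ‖Complex.exp u - 1‖ ≤ ‖u‖ * Real.exp ‖u‖ := by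
  have h := Complex.norm_exp_sub_sum_le_norm_mul_exp u 1
  simpa using h

namespace SubMarkov

variable {E : Type*} {p : E → (ℕ → E) → ℝ} {φ : (ℕ → E) → ℝ} {W : E → ℝ} {K V κ δ : ℝ}

theorem p_le (h : SubMarkov p φ W K V κ δ) (a : E) (ω : ℕ → E) : p a ω ≤ W a := by
  refine le_trans (le_mul_of_one_le_right (h.nonneg a ω) (Real.one_le_exp ?_)) (h.le a ω)
  have := h.δ_pos
  positivity

theorem W_nonneg (h : SubMarkov p φ W K V κ δ) (a : E) : 0 ≤ W a := by
  by_cases hE : Nonempty E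
  · obtain ⟨e⟩ := hE
    exact (h.nonneg a fun _ => e).trans (h.p_le a _)
  · exact (hE ⟨a⟩).elim

theorem summable_p (h : SubMarkov p φ W K V κ δ) (ω : ℕ → E) : Summable fun a => p a ω :=
  Summable.of_nonneg_of_le (fun a => h.nonneg a ω) (fun a => h.p_le a ω) h.summable

theorem abs_sub_le (h : SubMarkov p φ W K V κ δ) {N : ℕ} {ω ω' : ℕ → E} (hA : Agree N ω ω')
    (a : E) : |p a ω - p a ω'| ≤ K * Real.exp K * κ ^ N * p a ω := by
  have hK := h.K_nonneg
  have hκN : κ ^ N ≤ 1 := pow_le_one₀ h.κ_pos.le h.κ_lt.le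
  have hκN0 : 0 < κ ^ N := pow_pos h.κ_pos N
  set t := K * κ ^ N with ht
  have ht0 : 0 ≤ t := mul_nonneg hK hκN0.le
  have htK : t ≤ K := mul_le_of_le_one_right hK hκN
  have h1 := h.holder a N ω ω' hA
  have h2 := h.holder a N ω' ω hA.symm
  have hp := h.nonneg a ω
  have hp' := h.nonneg a ω'
  have he : Real.exp t * Real.exp (-t) = 1 := by rw [← Real.exp_add]; simp
  have h3 : 1 - t ≤ Real.exp (-t) := by have := Real.add_one_le_exp (-t); linarith
  have h4 : Real.exp t - 1 ≤ t * Real.exp t := by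
    have := mul_le_mul_of_nonneg_left h3 (Real.exp_pos t).le
    rw [he] at this
    linarith
  have h5 : t * Real.exp t ≤ t * Real.exp K := by gcongr
  have h6 : Real.exp (-t) * p a ω ≤ p a ω' := by
    calc Real.exp (-t) * p a ω ≤ Real.exp (-t) * (Real.exp t * p a ω') := by gcongr
      _ = p a ω' := by rw [← mul_assoc, mul_comm (Real.exp (-t)), he, one_mul]
  have h7 : t ≤ t * Real.exp K := le_mul_of_one_le_right ht0 (Real.one_le_exp hK)
  have h8 : K * Real.exp K * κ ^ N = t * Real.exp K := by rw [ht]; ring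
  rw [h8, abs_le]
  constructor
  · nlinarith
  · nlinarith

/-- The constant in the estimates for the perturbed weights. -/
def weightConst (K V δ : ℝ) : ℝ := δ⁻¹ * (K * Real.exp K) + V * Real.exp (δ * V) + δ⁻¹

theorem weightConst_nonneg (h : SubMarkov p φ W K V κ δ) : 0 ≤ weightConst K V δ := by
  have h1 := h.K_nonneg
  have h2 := h.V_nonneg
  have h3 := h.δ_pos
  unfold weightConst
  positivity

/-- The change of the weights caused by the tilt. -/
def pert (p : E → (ℕ → E) → ℝ) (φ : (ℕ → E) → ℝ) (w : ℂ) (a : E) (ω : ℕ → E) : ℂ :=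
  (p a ω : ℂ) * (Complex.exp (w * φ (cons a ω)) - 1)

theorem norm_pert_le' (h : SubMarkov p φ W K V κ δ) {w : ℂ} (hw : ‖w‖ ≤ δ) (a : E)
    (ω : ℕ → E) : ‖pert p φ w a ω‖ ≤ ‖w‖ * δ⁻¹ * W a := by
  have hδ := h.δ_pos
  have hp := h.nonneg a ω
  set x := φ (cons a ω) with hx
  have h1 : ‖Complex.exp (w * x) - 1‖ ≤ ‖w‖ * |x| * Real.exp (δ * |x|) := by
    refine (norm_exp_sub_one_le_mul_exp _).trans ?_
    rw [norm_mul, Complex.norm_real, Real.norm_eq_abs]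
    gcongr
  have h2 : |x| ≤ δ⁻¹ * Real.exp (δ * |x|) := by
    have := Real.add_one_le_exp (δ * |x|)
    rw [← div_eq_inv_mul, le_div_iff₀ hδ]
    linarith
  have h3 : Real.exp (2 * δ * |x|) = Real.exp (δ * |x|) * Real.exp (δ * |x|) := by
    rw [← Real.exp_add]; ring_nf
  calc ‖pert p φ w a ω‖ = p a ω * ‖Complex.exp (w * x) - 1‖ := by
        rw [pert, norm_mul, Complex.norm_real, Real.norm_of_nonneg hp]
    _ ≤ p a ω * (‖w‖ * (δ⁻¹ * Real.exp (δ * |x|)) * Real.exp (δ * |x|)) := by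
        refine mul_le_mul_of_nonneg_left (h1.trans ?_) hp
        gcongr
    _ = ‖w‖ * δ⁻¹ * (p a ω * Real.exp (2 * δ * |x|)) := by rw [h3]; ring
    _ ≤ ‖w‖ * δ⁻¹ * W a := by
        gcongr
        exact h.le a ω

theorem norm_pert_le (h : SubMarkov p φ W K V κ δ) {w : ℂ} (hw : ‖w‖ ≤ δ) (a : E)
    (ω : ℕ → E) : ‖pert p φ w a ω‖ ≤ ‖w‖ * weightConst K V δ * W a := by
  refine (h.norm_pert_le' hw a ω).trans ?_
  have h1 := h.K_nonneg
  have h2 := h.V_nonneg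
  have h3 := h.δ_pos
  have h4 := h.W_nonneg a
  gcongr
  unfold weightConst
  have : 0 ≤ δ⁻¹ * (K * Real.exp K) + V * Real.exp (δ * V) := by positivity
  linarith

theorem norm_pert_sub_le (h : SubMarkov p φ W K V κ δ) {w : ℂ} (hw : ‖w‖ ≤ δ) {N : ℕ}
    {ω ω' : ℕ → E} (hA : Agree N ω ω') (a : E) :
    ‖pert p φ w a ω - pert p φ w a ω'‖ ≤ ‖w‖ * weightConst K V δ * W a * κ ^ N := by
  have hδ := h.δ_pos
  have hK := h.K_nonneg
  have hV := h.V_nonneg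
  have hκ := h.κ_pos
  have hW := h.W_nonneg a
  have hκN : κ ^ N ≤ 1 := pow_le_one₀ h.κ_pos.le h.κ_lt.le
  set x := φ (cons a ω) with hx
  set y := φ (cons a ω') with hy
  have hxy : |x - y| ≤ V * κ ^ N := h.pot N _ _ (hA.cons a)
  have h1 : ‖((p a ω : ℂ) - p a ω') * (Complex.exp (w * x) - 1)‖ ≤
      K * Real.exp K * κ ^ N * (‖w‖ * δ⁻¹ * W a) := by
    have e1 := h.norm_pert_le' hw a ω
    rw [pert, norm_mul, Complex.norm_real, Real.norm_of_nonneg (h.nonneg a ω)] at e1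
    rw [norm_mul, ← Complex.ofReal_sub, Complex.norm_real, Real.norm_eq_abs]
    calc |p a ω - p a ω'| * ‖Complex.exp (w * x) - 1‖
        ≤ (K * Real.exp K * κ ^ N * p a ω) * ‖Complex.exp (w * x) - 1‖ := by
          gcongr
          exact h.abs_sub_le hA a
      _ = K * Real.exp K * κ ^ N * (p a ω * ‖Complex.exp (w * x) - 1‖) := by ring
      _ ≤ _ := by gcongr
  have h2 : ‖(p a ω' : ℂ) * (Complex.exp (w * x) - Complex.exp (w * y))‖ ≤
      ‖w‖ * (V * κ ^ N) * Real.exp (δ * V) * W a := by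
    have e1 : Complex.exp (w * x) - Complex.exp (w * y) =
        Complex.exp (w * y) * (Complex.exp (w * ((x - y : ℝ) : ℂ)) - 1) := by
      rw [mul_sub, ← Complex.exp_add]; push_cast; ring_nf
    have e2 : ‖Complex.exp (w * y)‖ ≤ Real.exp (2 * δ * |y|) := by
      refine (Complex.norm_exp_le_exp_norm _).trans (Real.exp_le_exp.2 ?_)
      rw [norm_mul, Complex.norm_real, Real.norm_eq_abs]
      gcongr
      linarith
    have e3 : ‖Complex.exp (w * ((x - y : ℝ) : ℂ)) - 1‖ ≤
        ‖w‖ * (V * κ ^ N) * Real.exp (δ * V) := by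
      refine (norm_exp_sub_one_le_mul_exp _).trans ?_
      rw [norm_mul, Complex.norm_real, Real.norm_eq_abs]
      have : ‖w‖ * |x - y| ≤ δ * V := by
        gcongr
        exact hxy.trans (mul_le_of_le_one_right hV hκN)
      gcongr
    rw [e1, norm_mul, Complex.norm_real, Real.norm_of_nonneg (h.nonneg a ω'), norm_mul]
    have hp := h.nonneg a ω'
    calc p a ω' * (‖Complex.exp (w * y)‖ * ‖Complex.exp (w * ((x - y : ℝ) : ℂ)) - 1‖)
        ≤ p a ω' * (Real.exp (2 * δ * |y|) * (‖w‖ * (V * κ ^ N) * Real.exp (δ * V))) := by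
          gcongr
      _ = ‖w‖ * (V * κ ^ N) * Real.exp (δ * V) * (p a ω' * Real.exp (2 * δ * |y|)) := by ring
      _ ≤ _ := by
          gcongr
          exact h.le a ω'
  have h3 : pert p φ w a ω - pert p φ w a ω' =
      ((p a ω : ℂ) - p a ω') * (Complex.exp (w * x) - 1) +
        (p a ω' : ℂ) * (Complex.exp (w * x) - Complex.exp (w * y)) := by
    simp only [pert]; ring
  rw [h3]
  refine (norm_add_le _ _).trans ((add_le_add h1 h2).trans ?_)
  have h4 : 0 ≤ ‖w‖ * δ⁻¹ * W a * κ ^ N := by positivity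
  unfold weightConst
  linarith

theorem norm_weight_le (h : SubMarkov p φ W K V κ δ) {w : ℂ} (hw : ‖w‖ ≤ δ) (a : E)
    (ω : ℕ → E) : ‖(p a ω : ℂ) * Complex.exp (w * φ (cons a ω))‖ ≤ W a := by
  rw [norm_mul, Complex.norm_real, Real.norm_of_nonneg (h.nonneg a ω)]
  refine le_trans (mul_le_mul_of_nonneg_left ?_ (h.nonneg a ω)) (h.le a ω)
  refine (Complex.norm_exp_le_exp_norm _).trans (Real.exp_le_exp.2 ?_)
  rw [norm_mul, Complex.norm_real, Real.norm_eq_abs]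
  have := h.δ_pos
  gcongr
  linarith

theorem norm_tilt_term_le (h : SubMarkov p φ W K V κ δ) {w : ℂ} (hw : ‖w‖ ≤ δ)
    {f : (ℕ → E) → ℂ} {B : ℝ} (hf : ∀ ω, ‖f ω‖ ≤ B) (ω : ℕ → E) (a : E) :
    ‖(p a ω : ℂ) * Complex.exp (w * φ (cons a ω)) * f (cons a ω)‖ ≤ W a * B := by
  rw [norm_mul]
  exact mul_le_mul (h.norm_weight_le hw a ω) (hf _) (norm_nonneg _) (h.W_nonneg a)

theorem summable_tilt (h : SubMarkov p φ W K V κ δ) {w : ℂ} (hw : ‖w‖ ≤ δ)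
    {f : (ℕ → E) → ℂ} {B : ℝ} (hf : ∀ ω, ‖f ω‖ ≤ B) (ω : ℕ → E) :
    Summable fun a => (p a ω : ℂ) * Complex.exp (w * φ (cons a ω)) * f (cons a ω) :=
  Summable.of_norm_bounded (h.summable.mul_right B) (h.norm_tilt_term_le hw hf ω)

theorem norm_tilt_le (h : SubMarkov p φ W K V κ δ) {w : ℂ} (hw : ‖w‖ ≤ δ)
    {f : (ℕ → E) → ℂ} {B : ℝ} (hf : ∀ ω, ‖f ω‖ ≤ B) (ω : ℕ → E) :
    ‖tilt p φ w f ω‖ ≤ (∑' a, W a) * B := by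
  rw [← tsum_mul_right]
  exact tsum_of_norm_bounded (h.summable.mul_right B).hasSum (h.norm_tilt_term_le hw hf ω)

theorem tilt_sum (h : SubMarkov p φ W K V κ δ) {w : ℂ} (hw : ‖w‖ ≤ δ) {n : ℕ}
    {f : ℕ → (ℕ → E) → ℂ} (hf : ∀ k, ∃ B, ∀ ω, ‖f k ω‖ ≤ B) (b : ℕ → ℂ) (ω : ℕ → E) :
    tilt p φ w (fun ω => ∑ k ∈ Finset.range n, b k * f k ω) ω =
      ∑ k ∈ Finset.range n, b k * tilt p φ w (f k) ω := by
  choose B hB using hf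
  unfold tilt
  simp_rw [← tsum_mul_left]
  rw [← Summable.tsum_finsetSum fun k _ => (h.summable_tilt hw (hB k) ω).mul_left _]
  refine tsum_congr fun a => ?_
  rw [Finset.mul_sum]
  exact Finset.sum_congr rfl fun k _ => by ring

theorem tilt_eq_add (h : SubMarkov p φ W K V κ δ) {w : ℂ} (hw : ‖w‖ ≤ δ)
    {f : (ℕ → E) → ℂ} {B : ℝ} (hf : ∀ ω, ‖f ω‖ ≤ B) (ω : ℕ → E) :
    tilt p φ w f ω = ∑' a, (p a ω : ℂ) * f (cons a ω) + ∑' a, pert p φ w a ω * f (cons a ω) := by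
  have h0 : Summable fun a => (p a ω : ℂ) * f (cons a ω) := by
    simpa using h.summable_tilt (w := 0) (by simpa using h.δ_pos.le) hf ω
  have h1 := h.summable_tilt hw hf ω
  have h2 : Summable fun a => pert p φ w a ω * f (cons a ω) :=
    (h1.sub h0).congr fun a => by simp only [pert]; ring
  rw [← h0.tsum_add h2]
  exact tsum_congr fun a => by simp only [pert]; ring

/-- The perturbation part of the tilted operator is small on Hölder functions. -/
theorem norm_tsum_pert_sub_le (h : SubMarkov p φ W K V κ δ) {D : ℕ → ℝ} {γ c : ℝ}
    (hD : IsGauge D γ c K κ) {w : ℂ} (hw : ‖w‖ ≤ δ)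
    {f : (ℕ → E) → ℂ} {A : ℝ} (hf : ∀ ω, ‖f ω‖ ≤ A)
    (hfD : ∀ N ω ω', Agree N ω ω' → ‖f ω - f ω'‖ ≤ A * D N) {N : ℕ} {ω ω' : ℕ → E}
    (hA : Agree N ω ω') :
    ‖∑' a, pert p φ w a ω * f (cons a ω) - ∑' a, pert p φ w a ω' * f (cons a ω')‖ ≤
      ‖w‖ * (weightConst K V δ * (c + 1) * ∑' a, W a) * (A * D N) := by
  have hC := h.weightConst_nonneg
  have hA0 : 0 ≤ A := (norm_nonneg _).trans (hf ω)
  have hs : ∀ ω, Summable fun a => pert p φ w a ω * f (cons a ω) := fun ω => by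
    refine Summable.of_norm_bounded
      ((h.summable.mul_left (‖w‖ * weightConst K V δ)).mul_right A) fun a => ?_
    rw [norm_mul]
    exact mul_le_mul (h.norm_pert_le hw a ω) (hf _) (norm_nonneg _)
      (mul_nonneg (mul_nonneg (norm_nonneg _) hC) (h.W_nonneg a))
  rw [← (hs ω).tsum_sub (hs ω')]
  have key : ∀ a, ‖pert p φ w a ω * f (cons a ω) - pert p φ w a ω' * f (cons a ω')‖ ≤
      (‖w‖ * (weightConst K V δ * (c + 1)) * (A * D N)) * W a := by
    intro a
    have hW := h.W_nonneg a
    have e1 : pert p φ w a ω * f (cons a ω) - pert p φ w a ω' * f (cons a ω') =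
        (pert p φ w a ω - pert p φ w a ω') * f (cons a ω) +
          pert p φ w a ω' * (f (cons a ω) - f (cons a ω')) := by ring
    rw [e1]
    refine (norm_add_le _ _).trans ?_
    rw [norm_mul, norm_mul]
    have hDN := (hD.pos N).le
    have e2 : ‖pert p φ w a ω - pert p φ w a ω'‖ * ‖f (cons a ω)‖ ≤
        (‖w‖ * weightConst K V δ * W a * (c * D N)) * A := by
      refine mul_le_mul ((h.norm_pert_sub_le hw hA a).trans ?_) (hf _) (norm_nonneg _) ?_
      · gcongr
        exact hD.pow_le N
      · have := hD.c_pos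
        positivity
    have e3 : ‖pert p φ w a ω'‖ * ‖f (cons a ω) - f (cons a ω')‖ ≤
        (‖w‖ * weightConst K V δ * W a) * (A * D N) := by
      refine mul_le_mul (h.norm_pert_le hw a ω') ((hfD _ _ _ (hA.cons a)).trans ?_)
        (norm_nonneg _) (by positivity)
      gcongr
      exact hD.anti N
    linarith
  refine (tsum_of_norm_bounded (h.summable.mul_left _).hasSum key).trans (le_of_eq ?_)
  rw [tsum_mul_left]
  ring

theorem norm_tsum_mul_one_sub_le (h : SubMarkov p φ W K V κ δ) {D : ℕ → ℝ} {γ c : ℝ}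
    (hD : IsGauge D γ c K κ) {N : ℕ} {ω ω' : ℕ → E} (hA : Agree N ω ω') :
    ‖∑' a, (p a ω : ℂ) * 1 - ∑' a, (p a ω' : ℂ) * 1‖ ≤ K * Real.exp K * c * D N := by
  simp only [mul_one]
  have hs : ∀ ω, Summable fun a => (p a ω : ℂ) := fun ω =>
    Complex.hasSum_ofReal.2 (h.summable_p ω).hasSum |>.summable
  rw [← (hs ω).tsum_sub (hs ω')]
  have hK := h.K_nonneg
  have hκ := h.κ_pos
  have key : ∀ a, ‖(p a ω : ℂ) - p a ω'‖ ≤ K * Real.exp K * κ ^ N * p a ω := fun a => by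
    rw [← Complex.ofReal_sub, Complex.norm_real]
    exact h.abs_sub_le hA a
  refine (tsum_of_norm_bounded ((h.summable_p ω).mul_left _).hasSum key).trans ?_
  rw [tsum_mul_left]
  calc K * Real.exp K * κ ^ N * ∑' a, p a ω ≤ K * Real.exp K * κ ^ N * 1 := by
        gcongr
        exact h.tsum_le ω
    _ ≤ K * Real.exp K * (c * D N) := by
        rw [mul_one]
        gcongr
        exact hD.pow_le N
    _ = _ := by ring

/-- One-step contraction of the tilted operator modulo constants. -/
theorem norm_tilt_sub_le (h : SubMarkov p φ W K V κ δ) {D : ℕ → ℝ} {γ c : ℝ}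
    (hD : IsGauge D γ c K κ) {w : ℂ} (hw : ‖w‖ ≤ δ) {o : ℕ → E}
    {f : (ℕ → E) → ℂ} {A : ℝ} (hfo : f o = 0)
    (hfD : ∀ N ω ω', Agree N ω ω' → ‖f ω - f ω'‖ ≤ A * D N) {N : ℕ} {ω ω' : ℕ → E}
    (hA : Agree N ω ω') :
    ‖tilt p φ w f ω - tilt p φ w f ω'‖ ≤
      (γ + ‖w‖ * (weightConst K V δ * (c + 1) * ∑' a, W a)) * (A * D N) := by
  have hA0 : 0 ≤ A := by
    have := (norm_nonneg _).trans (hfD 0 o o fun _ _ => rfl)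
    exact nonneg_of_mul_nonneg_left this (hD.pos 0)
  have hdiam : ∀ s t, ‖f s - f t‖ ≤ A := fun s t =>
    (hfD 0 s t fun _ hk => absurd hk (Nat.not_lt_zero _)).trans
      (mul_le_of_le_one_right hA0 (hD.le_one 0))
  have hf : ∀ s, ‖f s‖ ≤ A := fun s => by simpa [hfo] using hdiam s o
  rw [h.tilt_eq_add hw hf, h.tilt_eq_add hw hf, add_sub_add_comm]
  refine (norm_add_le _ _).trans ?_
  have h1 := h.norm_tsum_pert_sub_le hD hw hf hfD hA
  have hK := h.K_nonneg
  have hκ := h.κ_pos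
  have hm : Real.exp (-(K * κ ^ N)) ≤ 1 := by
    have : 0 ≤ K * κ ^ N := by positivity
    exact Real.exp_le_one_iff.2 (by linarith)
  have hcmp : ∀ {ω ω' : ℕ → E}, Agree N ω ω' → ∀ a,
      Real.exp (-(K * κ ^ N)) * p a ω ≤ p a ω' := by
    intro ω ω' hA a
    rw [Real.exp_neg, ← div_eq_inv_mul, div_le_iff₀ (Real.exp_pos _), mul_comm]
    exact h.holder a N ω ω' hA
  have h2 := norm_tsum_mul_sub_tsum_mul_le (x := fun a => cons a ω) (y := fun a => cons a ω')
    (fun a => h.nonneg a ω) (fun a => h.nonneg a ω')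
    (h.summable_p ω) (h.summable_p ω') (h.tsum_le ω) (h.tsum_le ω') (Real.exp_pos _).le hm
    (hcmp hA) (hcmp hA.symm) (hD.pos (N + 1)).le (hD.le_one _) hfo hdiam
    (fun a => hfD _ _ _ (hA.cons a))
  have h3 := mul_le_mul_of_nonneg_left (hD.contract N) hA0
  linarith

theorem tiltSeq_succ_base (o : ℕ → E) (w : ℂ) (k : ℕ) : tiltSeq p φ o w (k + 1) o = 0 := by
  simp [tiltSeq]

theorem exists_norm_tiltSeq_le (h : SubMarkov p φ W K V κ δ) (o : ℕ → E) (k : ℕ) :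
    ∃ B, ∀ w : ℂ, ‖w‖ ≤ δ → ∀ ω, ‖tiltSeq p φ o w k ω‖ ≤ B := by
  induction k with
  | zero => exact ⟨1, fun w _ ω => by simp [tiltSeq]⟩
  | succ k ih =>
    obtain ⟨B, hB⟩ := ih
    refine ⟨(∑' a, W a) * B + (∑' a, W a) * B, fun w hw ω => ?_⟩
    exact (norm_sub_le _ _).trans
      (add_le_add (h.norm_tilt_le hw (hB w hw) ω) (h.norm_tilt_le hw (hB w hw) o))

theorem differentiableOn_tilt (h : SubMarkov p φ W K V κ δ) {f : ℂ → (ℕ → E) → ℂ} {B : ℝ}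
    (hf : ∀ w : ℂ, ‖w‖ ≤ δ → ∀ ω, ‖f w ω‖ ≤ B)
    (hfd : ∀ ω, DifferentiableOn ℂ (fun w => f w ω) (ball 0 δ)) (ω : ℕ → E) :
    DifferentiableOn ℂ (fun w => tilt p φ w (f w) ω) (ball 0 δ) := by
  refine Complex.differentiableOn_tsum_of_summable_norm (h.summable.mul_right B) (fun a => ?_)
    isOpen_ball fun a w hw => ?_
  · refine DifferentiableOn.mul (DifferentiableOn.mul (differentiableOn_const _) ?_) (hfd _)
    fun_prop
  · have hw' : ‖w‖ ≤ δ := by simpa using (mem_ball.1 hw).le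
    exact h.norm_tilt_term_le hw' (hf w hw') ω a

theorem differentiableOn_tiltSeq (h : SubMarkov p φ W K V κ δ) (o : ℕ → E) (k : ℕ) (ω : ℕ → E) :
    DifferentiableOn ℂ (fun w => tiltSeq p φ o w k ω) (ball 0 δ) := by
  induction k generalizing ω with
  | zero => exact differentiableOn_const _
  | succ k ih =>
    obtain ⟨B, hB⟩ := h.exists_norm_tiltSeq_le o k
    exact (h.differentiableOn_tilt hB ih ω).sub (h.differentiableOn_tilt hB ih o)

theorem renewal (h : SubMarkov p φ W K V κ δ) {w : ℂ} (hw : ‖w‖ ≤ δ) (o : ℕ → E)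
    {G : ℕ → (ℕ → E) → ℂ} (hG0 : ∀ ω, G 0 ω = 1)
    (hG : ∀ n ω, G (n + 1) ω = tilt p φ w (G n) ω) (n : ℕ) :
    G (n + 1) o =
      ∑ k ∈ Finset.range (n + 1), tilt p φ w (tiltSeq p φ o w k) o * G (n - k) o := by
  have hB : ∀ k, ∃ B, ∀ ω, ‖tiltSeq p φ o w k ω‖ ≤ B := fun k =>
    (h.exists_norm_tiltSeq_le o k).imp fun B hB => hB w hw
  have hdec : ∀ n ω, G n ω = ∑ k ∈ Finset.range (n + 1), G (n - k) o * tiltSeq p φ o w k ω := by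
    intro n
    induction n with
    | zero => intro ω; simp [hG0, tiltSeq]
    | succ n ih =>
      have hstep : ∀ ω, G (n + 1) ω =
          ∑ k ∈ Finset.range (n + 1), G (n - k) o * tilt p φ w (tiltSeq p φ o w k) ω := by
        intro ω
        rw [hG, show G n = _ from funext ih, h.tilt_sum hw hB]
      intro ω
      rw [Finset.sum_range_succ']
      simp only [Nat.add_sub_add_right, Nat.sub_zero, tiltSeq, mul_one, mul_sub,
        Finset.sum_sub_distrib]
      rw [← hstep ω, ← hstep o]
      ring
  rw [hG, show G n = _ from funext (hdec n), h.tilt_sum hw hB]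
  exact Finset.sum_congr rfl fun k _ => mul_comm _ _

theorem exists_renewal (h : SubMarkov p φ W K V κ δ) {D : ℕ → ℝ} {γ c γ' : ℝ}
    (hD : IsGauge D γ c K κ) (hγ : γ < γ') (o : ℕ → E) :
    ∃ δ₁ > 0, δ₁ ≤ δ ∧ ∃ (C : ℝ) (a : ℕ → ℂ → ℂ),
      (∀ k, DifferentiableOn ℂ (a k) (ball 0 δ₁)) ∧
      (∀ k, ∀ w ∈ ball (0 : ℂ) δ₁, ‖a k w‖ ≤ C * γ' ^ k) ∧
      ∀ w ∈ ball (0 : ℂ) δ₁, ∀ G : ℕ → (ℕ → E) → ℂ, (∀ ω, G 0 ω = 1) →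
        (∀ n ω, G (n + 1) ω = tilt p φ w (G n) ω) → ∀ n,
        G (n + 1) o = ∑ k ∈ Finset.range (n + 1), a k w * G (n - k) o := by
  have hδ := h.δ_pos
  set C' := weightConst K V δ * (c + 1) * ∑' a, W a with hC'
  have hC'0 : 0 ≤ C' := by
    have := h.weightConst_nonneg
    have : 0 ≤ ∑' a, W a := tsum_nonneg h.W_nonneg
    have := hD.c_pos
    positivity
  have hγ0 : 0 < γ' := hD.γ_pos.trans hγ
  set δ₁ := min δ ((γ' - γ) / (C' + 1)) with hδ₁
  have hδ₁0 : 0 < δ₁ := lt_min hδ (div_pos (by linarith) (by linarith))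
  have hδ₁δ : δ₁ ≤ δ := min_le_left _ _
  have hδ₁C : δ₁ * C' ≤ γ' - γ := by
    have h1 : δ₁ ≤ (γ' - γ) / (C' + 1) := min_le_right _ _
    rw [le_div_iff₀ (by linarith)] at h1
    nlinarith
  set A := K * Real.exp K * c + δ * C' with hA
  have hA0 : 0 ≤ A := by
    have := h.K_nonneg
    have := hD.c_pos
    positivity
  have hwδ : ∀ w ∈ ball (0 : ℂ) δ₁, ‖w‖ ≤ δ := fun w hw =>
    (by simpa using (mem_ball.1 hw).le : ‖w‖ ≤ δ₁).trans hδ₁δ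
  have hlip : ∀ w ∈ ball (0 : ℂ) δ₁, ∀ k N ω ω', Agree N ω ω' →
      ‖tiltSeq p φ o w (k + 1) ω - tiltSeq p φ o w (k + 1) ω'‖ ≤ A * γ' ^ k * D N := by
    intro w hw k
    have hw' := hwδ w hw
    have hw₁ : ‖w‖ ≤ δ₁ := by simpa using (mem_ball.1 hw).le
    induction k with
    | zero =>
      intro N ω ω' hAg
      have h1 : ∀ s : ℕ → E, ‖tiltSeq p φ o w 0 s‖ ≤ 1 := fun s => by simp [tiltSeq]
      have hDN := (hD.pos N).le
      simp only [tiltSeq, sub_sub_sub_cancel_right, pow_zero, mul_one]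
      rw [h.tilt_eq_add hw' (B := 1) (by simp), h.tilt_eq_add hw' (B := 1) (by simp),
        add_sub_add_comm]
      refine (norm_add_le _ _).trans ?_
      have h2 := h.norm_tsum_mul_one_sub_le hD hAg
      have h3 := h.norm_tsum_pert_sub_le hD hw' (f := fun _ => 1) (A := 1) (by simp)
        (fun N _ _ _ => by simpa using (hD.pos N).le) hAg
      rw [← hC', one_mul] at h3
      have h4 : ‖w‖ * C' * D N ≤ δ * C' * D N := by gcongr
      rw [hA]
      linarith
    | succ k ih =>
      intro N ω ω' hAg
      rw [tiltSeq]
      simp only [sub_sub_sub_cancel_right]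
      refine (h.norm_tilt_sub_le hD hw' (tiltSeq_succ_base o w k) ih hAg).trans ?_
      rw [← hC']
      have h1 : γ + ‖w‖ * C' ≤ γ' := by
        have : ‖w‖ * C' ≤ δ₁ * C' := by gcongr
        linarith
      have hDN := (hD.pos N).le
      calc (γ + ‖w‖ * C') * (A * γ' ^ k * D N) ≤ γ' * (A * γ' ^ k * D N) := by gcongr
        _ = _ := by ring
  have hS : 0 ≤ ∑' a, W a := tsum_nonneg h.W_nonneg
  refine ⟨δ₁, hδ₁0, hδ₁δ, (∑' a, W a) * (1 + A / γ'), fun k w => tilt p φ w (tiltSeq p φ o w k) o,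
    fun k => ?_, fun k w hw => ?_, fun w hw G hG0 hG => h.renewal (hwδ w hw) o hG0 hG⟩
  · obtain ⟨B, hB⟩ := h.exists_norm_tiltSeq_le o k
    exact (h.differentiableOn_tilt hB (h.differentiableOn_tiltSeq o k) o).mono
      (ball_subset_ball hδ₁δ)
  · rw [mul_assoc]
    refine h.norm_tilt_le (hwδ w hw) (fun ω => ?_) o
    cases k with
    | zero =>
      simp only [tiltSeq, norm_one, pow_zero, mul_one]
      have : 0 ≤ A / γ' := by positivity
      linarith
    | succ k =>
      have h1 := hlip w hw k 0 ω o fun _ hk => absurd hk (Nat.not_lt_zero _)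
      rw [tiltSeq_succ_base, sub_zero] at h1
      have h2 : A * γ' ^ k * D 0 ≤ A * γ' ^ k := mul_le_of_le_one_right (by positivity) (hD.le_one 0)
      have h3 : A / γ' * γ' ^ (k + 1) = A * γ' ^ k := by rw [pow_succ]; field_simp
      have h4 : 0 ≤ γ' ^ (k + 1) := by positivity
      nlinarith

end SubMarkov

/-- The transfer operator of the potential `s * φ` on one-sided sequences. -/
def transfer {E : Type*} (φ : (ℕ → E) → ℝ) (s : ℝ) (f : (ℕ → E) → ℝ) (ω : ℕ → E) : ℝ :=
  ∑' a, Real.exp (s * φ (cons a ω)) * f (cons a ω)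

section Transfer

variable {E : Type*} {φ : (ℕ → E) → ℝ} {s : ℝ} {M : E → ℝ}

theorem transfer_summable (hM : Summable M) (hφ : ∀ a ω, Real.exp (s * φ (cons a ω)) ≤ M a)
    {f : (ℕ → E) → ℝ} {B : ℝ} (hf0 : ∀ ω, 0 ≤ f ω) (hf : ∀ ω, f ω ≤ B) (ω : ℕ → E) :
    Summable fun a => Real.exp (s * φ (cons a ω)) * f (cons a ω) := by
  refine Summable.of_nonneg_of_le (fun a => mul_nonneg (Real.exp_pos _).le (hf0 _)) (fun a => ?_)
    (hM.mul_right B)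
  exact mul_le_mul (hφ a ω) (hf _) (hf0 _) ((Real.exp_pos _).le.trans (hφ a ω))

theorem transfer_nonneg {f : (ℕ → E) → ℝ} (hf0 : ∀ ω, 0 ≤ f ω) (ω : ℕ → E) :
    0 ≤ transfer φ s f ω :=
  tsum_nonneg fun _ => mul_nonneg (Real.exp_pos _).le (hf0 _)

theorem transfer_const_mul (c : ℝ) (f : (ℕ → E) → ℝ) (ω : ℕ → E) :
    transfer φ s (fun ω => c * f ω) ω = c * transfer φ s f ω := by
  simp only [transfer]
  rw [← tsum_mul_left]
  exact tsum_congr fun a => by ring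

theorem transfer_mono (hM : Summable M) (hφ : ∀ a ω, Real.exp (s * φ (cons a ω)) ≤ M a)
    {f g : (ℕ → E) → ℝ} {B : ℝ} (hf0 : ∀ ω, 0 ≤ f ω) (hfg : ∀ ω, f ω ≤ g ω)
    (hg : ∀ ω, g ω ≤ B) (ω : ℕ → E) : transfer φ s f ω ≤ transfer φ s g ω :=
  (transfer_summable hM hφ hf0 (fun ω => (hfg ω).trans (hg ω)) ω).tsum_le_tsum
    (fun _ => mul_le_mul_of_nonneg_left (hfg _) (Real.exp_pos _).le)
    (transfer_summable hM hφ (fun ω => (hf0 ω).trans (hfg ω)) hg ω)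

theorem transfer_sum (hM : Summable M) (hφ : ∀ a ω, Real.exp (s * φ (cons a ω)) ≤ M a)
    {f : ℕ → (ℕ → E) → ℝ} (hf0 : ∀ k ω, 0 ≤ f k ω) (hf : ∀ k, ∃ B, ∀ ω, f k ω ≤ B) (c : ℕ → ℝ)
    (n : ℕ) (ω : ℕ → E) :
    transfer φ s (fun ω => ∑ k ∈ Finset.range n, c k * f k ω) ω =
      ∑ k ∈ Finset.range n, c k * transfer φ s (f k) ω := by
  choose B hB using hf
  unfold transfer
  simp_rw [← tsum_mul_left]
  rw [← Summable.tsum_finsetSum fun k _ =>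
    (transfer_summable hM hφ (hf0 k) (hB k) ω).mul_left (c k)]
  refine tsum_congr fun a => ?_
  rw [Finset.mul_sum]
  exact Finset.sum_congr rfl fun k _ => by ring

/-- Iterates of the transfer operator of a function between `1` and `H`. -/
theorem transfer_iterate_between (hM : Summable M)
    (hφ : ∀ a ω, Real.exp (s * φ (cons a ω)) ≤ M a) {h : (ℕ → E) → ℝ} {H : ℝ}
    (h1 : ∀ ω, 1 ≤ h ω) (hH : ∀ ω, h ω ≤ H)
    (hB : ∀ n, ∃ B, ∀ ω, (transfer φ s)^[n] (fun _ => 1) ω ≤ B) (n : ℕ) (ω : ℕ → E) :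
    0 ≤ (transfer φ s)^[n] (fun _ => 1) ω ∧
      (transfer φ s)^[n] (fun _ => 1) ω ≤ (transfer φ s)^[n] h ω ∧
      (transfer φ s)^[n] h ω ≤ H * (transfer φ s)^[n] (fun _ => 1) ω := by
  have hH0 : 0 ≤ H := by linarith [h1 ω, hH ω]
  induction n generalizing ω with
  | zero => simpa using ⟨h1 ω, hH ω⟩
  | succ n ih =>
    simp only [Function.iterate_succ_apply']
    obtain ⟨B, hB⟩ := hB n
    have hHB : ∀ ω, H * (transfer φ s)^[n] (fun _ => 1) ω ≤ H * B := fun ω =>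
      mul_le_mul_of_nonneg_left (hB ω) hH0
    refine ⟨transfer_nonneg (fun ω => (ih ω).1) ω, ?_, ?_⟩
    · exact transfer_mono hM hφ (fun ω => (ih ω).1) (fun ω => (ih ω).2.1)
        (fun ω => (ih ω).2.2.trans (hHB ω)) ω
    · rw [← transfer_const_mul]
      exact transfer_mono hM hφ (fun ω => (ih ω).1.trans (ih ω).2.1) (fun ω => (ih ω).2.2) hHB ω

theorem transfer_iterate_holder {κ V K : ℝ} (hM : Summable M)
    (hφ : ∀ a ω, Real.exp (s * φ (cons a ω)) ≤ M a)
    (hV : ∀ N ω ω', Agree (N + 1) ω ω' → |φ ω - φ ω'| ≤ V * κ ^ N)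
    (hK : |s| * V + K * κ = K) (hK0 : 0 ≤ K) (hκ : 0 ≤ κ)
    (hB : ∀ n, ∃ B, ∀ ω, (transfer φ s)^[n] (fun _ => 1) ω ≤ B) (n N : ℕ) (ω ω' : ℕ → E)
    (hA : Agree N ω ω') :
    0 ≤ (transfer φ s)^[n] (fun _ => 1) ω ∧ (transfer φ s)^[n] (fun _ => 1) ω ≤
      Real.exp (K * κ ^ N) * (transfer φ s)^[n] (fun _ => 1) ω' := by
  induction n generalizing N ω ω' with
  | zero => simpa using mul_nonneg hK0 (pow_nonneg hκ N)
  | succ n ih =>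
    simp only [Function.iterate_succ_apply']
    obtain ⟨B, hB⟩ := hB n
    have h0 : ∀ ω, 0 ≤ (transfer φ s)^[n] (fun _ => 1) ω := fun ω => (ih N ω ω fun _ _ => rfl).1
    refine ⟨transfer_nonneg h0 ω, ?_⟩
    rw [transfer, transfer, ← tsum_mul_left]
    refine (transfer_summable hM hφ h0 hB ω).tsum_le_tsum (fun a => ?_)
      ((transfer_summable hM hφ h0 hB ω').mul_left _)
    have h1 := (ih (N + 1) _ _ (hA.cons a)).2
    have h2 : s * φ (cons a ω) ≤ |s| * V * κ ^ N + s * φ (cons a ω') := by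
      have h3 : |s * (φ (cons a ω) - φ (cons a ω'))| ≤ |s| * (V * κ ^ N) := by
        rw [abs_mul]
        exact mul_le_mul_of_nonneg_left (hV N _ _ (hA.cons a)) (abs_nonneg s)
      have := (abs_le.1 h3).2
      linarith
    have h4 : K * κ ^ N = |s| * V * κ ^ N + K * κ ^ (N + 1) := by
      rw [pow_succ]; linear_combination (-κ ^ N) * hK
    calc Real.exp (s * φ (cons a ω)) * (transfer φ s)^[n] (fun _ => 1) (cons a ω)
        ≤ Real.exp (|s| * V * κ ^ N + s * φ (cons a ω')) *
          (Real.exp (K * κ ^ (N + 1)) * (transfer φ s)^[n] (fun _ => 1) (cons a ω')) :=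
          mul_le_mul (Real.exp_le_exp.2 h2) h1 (h0 _) (Real.exp_pos _).le
      _ = _ := by rw [h4, Real.exp_add, Real.exp_add]; ring

end Transfer

/-- A one-sided pressure function, characterised by the growth of the iterates of the transfer
operators, is real-analytic. -/
theorem analyticAt_of_transfer_growth {E : Type*} [Nonempty E] {φ : (ℕ → E) → ℝ} {κ V : ℝ}
    (hκ0 : 0 < κ) (hκ1 : κ < 1) (hV0 : 0 ≤ V)
    (hV : ∀ N ω ω', Agree (N + 1) ω ω' → |φ ω - φ ω'| ≤ V * κ ^ N)
    {s₀ ε : ℝ} (hε : 0 < ε) {M : E → ℝ} (hM : Summable M)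
    (hφM : ∀ a ω, Real.exp (s₀ * φ (cons a ω)) * Real.exp (ε * |φ (cons a ω)|) ≤ M a)
    {P : ℝ → ℝ} (hP : ContinuousAt P s₀)
    (hgrowth : ∀ s ∈ ball s₀ ε, ∃ c₁ > 0, ∃ c₂, ∀ (n : ℕ) ω,
      c₁ * Real.exp (P s) ^ n ≤ (transfer φ s)^[n] (fun _ => 1) ω ∧
      (transfer φ s)^[n] (fun _ => 1) ω ≤ c₂ * Real.exp (P s) ^ n) :
    AnalyticAt ℝ P s₀ := by
  obtain ⟨e⟩ := ‹Nonempty E›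
  set o : ℕ → E := fun _ => e
  have hφs : ∀ s ∈ ball s₀ ε, ∀ a ω, Real.exp (s * φ (cons a ω)) ≤ M a := by
    intro s hs a ω
    refine le_trans ?_ (hφM a ω)
    rw [← Real.exp_add, Real.exp_le_exp]
    have h1 : |(s - s₀) * φ (cons a ω)| ≤ ε * |φ (cons a ω)| := by
      rw [abs_mul]
      gcongr
      rw [← Real.dist_eq]
      exact (mem_ball.1 hs).le
    have := (abs_le.1 h1).2
    linarith
  have hs₀ : s₀ ∈ ball s₀ ε := mem_ball_self hε
  have hbd : ∀ s ∈ ball s₀ ε, ∀ n, ∃ B, ∀ ω, (transfer φ s)^[n] (fun _ => 1) ω ≤ B := by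
    intro s hs n
    obtain ⟨c₁, hc₁, c₂, hc⟩ := hgrowth s hs
    exact ⟨_, fun ω => (hc n ω).2⟩
  set K₁ := |s₀| * V / (1 - κ) with hK₁
  have h1κ : 0 < 1 - κ := by linarith
  have hK₁0 : 0 ≤ K₁ := by positivity
  have hK₁eq : |s₀| * V + K₁ * κ = K₁ := by rw [hK₁]; field_simp; ring
  obtain ⟨D, γ, c, g1, g2, g3, g4, g5, g6, g7, g8⟩ :=
    exists_gauge (K := 2 * K₁) hκ0 hκ1 (by linarith)
  have hD : IsGauge D γ c (2 * K₁) κ := ⟨g1, g2, g3, g4, g5, g6, g7, g8⟩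
  set γ' := (1 + γ) / 2 with hγ'
  have hγγ' : γ < γ' := by linarith
  have hγ'1 : γ' < 1 := by linarith
  have hγ'0 : 0 < γ' := by linarith
  set ρ := Real.exp (P s₀) with hρ
  have hρ0 : 0 < ρ := Real.exp_pos _
  set x := (1 + γ') / 2 / ρ with hx
  have hx0 : 0 < x := by positivity
  have hxρ : x * ρ = (1 + γ') / 2 := by rw [hx]; field_simp
  obtain ⟨c₁, hc₁, c₂, hc⟩ := hgrowth s₀ hs₀
  set g : ℕ → (ℕ → E) → ℝ := fun k => (transfer φ s₀)^[k] fun _ => 1 with hg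
  have hghol : ∀ k N ω ω', Agree N ω ω' → 0 ≤ g k ω ∧ g k ω ≤ Real.exp (K₁ * κ ^ N) * g k ω' :=
    transfer_iterate_holder hM (hφs s₀ hs₀) hV hK₁eq hK₁0 hκ0.le (hbd s₀ hs₀)
  have hg0 : ∀ k ω, 0 ≤ g k ω := fun k ω => (hghol k 0 ω ω fun _ _ => rfl).1
  obtain ⟨n₀, hn₀⟩ : ∃ n₀ : ℕ, c₂ * (x * ρ) ^ (n₀ + 1) ≤ 1 := by
    have h := ((tendsto_pow_atTop_nhds_zero_of_lt_one (by positivity)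
      (show x * ρ < 1 by linarith)).comp (tendsto_add_atTop_nat 1)).const_mul c₂
    rw [mul_zero] at h
    obtain ⟨N, hN⟩ := (h.eventually (gt_mem_nhds one_pos)).exists
    exact ⟨N, hN.le⟩
  set h : (ℕ → E) → ℝ := fun ω => ∑ k ∈ Finset.range (n₀ + 1), x ^ k * g k ω with hh
  have hterm0 : ∀ k ω, 0 ≤ x ^ k * g k ω := fun k ω => mul_nonneg (by positivity) (hg0 k ω)
  have hh1 : ∀ ω, 1 ≤ h ω := by
    intro ω
    simp only [hh]
    rw [Finset.sum_range_succ']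
    have : 0 ≤ ∑ k ∈ Finset.range n₀, x ^ (k + 1) * g (k + 1) ω :=
      Finset.sum_nonneg fun k _ => hterm0 _ _
    simpa [hg] using this
  have hh0 : ∀ ω, 0 < h ω := fun ω => one_pos.trans_le (hh1 ω)
  obtain ⟨H, hH⟩ : ∃ H, ∀ ω, h ω ≤ H :=
    ⟨∑ k ∈ Finset.range (n₀ + 1), x ^ k * (c₂ * ρ ^ k), fun ω =>
      Finset.sum_le_sum fun k _ => mul_le_mul_of_nonneg_left (hc k ω).2 (by positivity)⟩
  have hH0 : 0 < H := (hh0 o).trans_le (hH o)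
  have hhol : ∀ N ω ω', Agree N ω ω' → h ω ≤ Real.exp (K₁ * κ ^ N) * h ω' := by
    intro N ω ω' hA
    simp only [hh]
    rw [Finset.mul_sum]
    refine Finset.sum_le_sum fun k _ => ?_
    have := mul_le_mul_of_nonneg_left (hghol k N ω ω' hA).2 (pow_pos hx0 k).le
    linarith
  have hLh : ∀ ω, x * transfer φ s₀ h ω ≤ h ω := by
    intro ω
    simp only [hh]
    rw [transfer_sum hM (hφs s₀ hs₀) hg0 (hbd s₀ hs₀), Finset.mul_sum]
    have e1 : ∀ k, x * (x ^ k * transfer φ s₀ (g k) ω) = x ^ (k + 1) * g (k + 1) ω := by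
      intro k
      simp only [hg, Function.iterate_succ_apply', pow_succ]
      ring
    rw [Finset.sum_congr rfl fun k _ => e1 k]
    have e2 := Finset.sum_range_succ' (fun k => x ^ k * g k ω) (n₀ + 1)
    have e3 := Finset.sum_range_succ (fun k => x ^ k * g k ω) (n₀ + 1)
    have e4 : x ^ (n₀ + 1) * g (n₀ + 1) ω ≤ 1 := by
      calc x ^ (n₀ + 1) * g (n₀ + 1) ω ≤ x ^ (n₀ + 1) * (c₂ * ρ ^ (n₀ + 1)) :=
            mul_le_mul_of_nonneg_left (hc _ ω).2 (by positivity)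
        _ = c₂ * (x * ρ) ^ (n₀ + 1) := by rw [mul_pow]; ring
        _ ≤ 1 := hn₀
    have e5 : x ^ 0 * g 0 ω = 1 := by simp [hg]
    linarith
  set p : E → (ℕ → E) → ℝ := fun a ω => x * Real.exp (s₀ * φ (cons a ω)) * h (cons a ω) / h ω
    with hp
  have hSM : SubMarkov p φ (fun a => x * H * M a) (2 * K₁) V κ (ε / 2) := by
    refine ⟨by linarith, hV0, hκ0, hκ1, by linarith, fun a ω => ?_, fun ω => ?_,
      fun a N ω ω' hA => ?_, hV, hM.mul_left _, fun a ω => ?_⟩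
    · have := hh0 ω
      have := hh0 (cons a ω)
      positivity
    · have e1 : ∑' a, p a ω = x * transfer φ s₀ h ω / h ω := by
        simp only [hp, transfer]
        rw [← tsum_mul_left, ← tsum_div_const]
        exact tsum_congr fun a => by ring
      rw [e1, div_le_one (hh0 ω)]
      exact hLh ω
    · have e1 := hhol (N + 1) _ _ (hA.cons a)
      have e2 := hhol N _ _ hA.symm
      have e3 : s₀ * φ (cons a ω) ≤ |s₀| * V * κ ^ N + s₀ * φ (cons a ω') := by
        have h3 : |s₀ * (φ (cons a ω) - φ (cons a ω'))| ≤ |s₀| * (V * κ ^ N) := by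
          rw [abs_mul]
          exact mul_le_mul_of_nonneg_left (hV N _ _ (hA.cons a)) (abs_nonneg _)
        have := (abs_le.1 h3).2
        linarith
      have h4 : 2 * K₁ * κ ^ N = |s₀| * V * κ ^ N + K₁ * κ ^ (N + 1) + K₁ * κ ^ N := by
        rw [pow_succ]; linear_combination (-κ ^ N) * hK₁eq
      have i1 := hh0 ω
      have i2 := hh0 ω'
      have i3 := hh0 (cons a ω')
      simp only [hp]
      rw [div_le_iff₀ i1]
      calc x * Real.exp (s₀ * φ (cons a ω)) * h (cons a ω)
          ≤ x * Real.exp (|s₀| * V * κ ^ N + s₀ * φ (cons a ω')) *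
            (Real.exp (K₁ * κ ^ (N + 1)) * h (cons a ω')) := by
            have := hh0 (cons a ω)
            gcongr
        _ = (Real.exp (|s₀| * V * κ ^ N) * Real.exp (K₁ * κ ^ (N + 1))) *
            (x * Real.exp (s₀ * φ (cons a ω')) * h (cons a ω') / h ω') * h ω' := by
            rw [Real.exp_add]; field_simp
        _ ≤ (Real.exp (|s₀| * V * κ ^ N) * Real.exp (K₁ * κ ^ (N + 1))) *
            (x * Real.exp (s₀ * φ (cons a ω')) * h (cons a ω') / h ω') *
            (Real.exp (K₁ * κ ^ N) * h ω) := by gcongr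
        _ = _ := by rw [h4, Real.exp_add, Real.exp_add]; ring
    · have i1 := hh0 ω
      have e1 : p a ω ≤ x * Real.exp (s₀ * φ (cons a ω)) * H := by
        simp only [hp]
        rw [div_le_iff₀ i1]
        calc x * Real.exp (s₀ * φ (cons a ω)) * h (cons a ω)
            ≤ x * Real.exp (s₀ * φ (cons a ω)) * H * 1 := by
              rw [mul_one]; gcongr; exact hH _
          _ ≤ _ := by gcongr; exact hh1 ω
      calc p a ω * Real.exp (2 * (ε / 2) * |φ (cons a ω)|)
          ≤ x * Real.exp (s₀ * φ (cons a ω)) * H * Real.exp (2 * (ε / 2) * |φ (cons a ω)|) := by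
            gcongr
        _ = x * H * (Real.exp (s₀ * φ (cons a ω)) * Real.exp (ε * |φ (cons a ω)|)) := by
            rw [show 2 * (ε / 2) = ε by ring]; ring
        _ ≤ _ := by gcongr; exact hφM a ω
  obtain ⟨δ₁, hδ₁0, hδ₁ε, C, a, ha1, ha2, ha3⟩ := hSM.exists_renewal hD hγγ' o
  have hballs : ∀ s ∈ ball s₀ δ₁, s ∈ ball s₀ ε := fun s hs =>
    ball_subset_ball (by linarith) hs
  have hmaps : MapsTo (fun z : ℂ => z - s₀) (ball (s₀ : ℂ) δ₁) (ball 0 δ₁) := fun z hz => by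
    simpa [dist_eq_norm] using hz
  have hr : AnalyticAt ℝ (fun s => x * Real.exp (P s)) s₀ := by
    refine analyticAt_of_renewal (a := fun k z => a k (z - s₀)) (C := C)
      (b := fun s n => x ^ n * (transfer φ s)^[n] h o / h o) hδ₁0 hγ'0 (fun k => ?_)
      (fun k z hz => ha2 k _ (hmaps hz)) (by fun_prop) (by linarith) (fun s hs => ?_)
      (fun s hs n => ?_)
    · exact (ha1 k).comp (by fun_prop) hmaps
    · obtain ⟨d₁, hd₁, d₂, hd⟩ := hgrowth s (hballs s hs)
      refine ⟨d₁ / H, by positivity, H * d₂, fun n => ?_⟩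
      obtain ⟨i0, i1, i2⟩ := transfer_iterate_between hM (hφs s (hballs s hs)) hh1 hH
        (hbd s (hballs s hs)) n o
      obtain ⟨j1, j2⟩ := hd n o
      have i3 := hh0 o
      have i4 : 0 ≤ (transfer φ s)^[n] h o := i0.trans i1
      constructor
      · rw [le_div_iff₀ i3]
        calc d₁ / H * (x * Real.exp (P s)) ^ n * h o
            ≤ d₁ / H * (x * Real.exp (P s)) ^ n * H := by gcongr; exact hH o
          _ = x ^ n * (d₁ * Real.exp (P s) ^ n) := by rw [mul_pow]; field_simp
          _ ≤ _ := by gcongr; exact j1.trans i1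
      · rw [div_le_iff₀ i3]
        calc x ^ n * (transfer φ s)^[n] h o ≤ x ^ n * (H * (d₂ * Real.exp (P s) ^ n)) := by
              gcongr
              exact i2.trans (mul_le_mul_of_nonneg_left j2 hH0.le)
          _ = H * d₂ * (x * Real.exp (P s)) ^ n * 1 := by rw [mul_pow]; ring
          _ ≤ _ := by
              have k1 : 0 ≤ d₂ * Real.exp (P s) ^ n := i0.trans j2
              have k2 : 0 ≤ H * d₂ * (x * Real.exp (P s)) ^ n := by
                rw [mul_pow]
                have : H * d₂ * (x ^ n * Real.exp (P s) ^ n) =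
                  H * x ^ n * (d₂ * Real.exp (P s) ^ n) := by ring
                rw [this]
                positivity
              gcongr
              exact hh1 o
    · have hw : ((s : ℂ) - s₀) ∈ ball (0 : ℂ) δ₁ := by
        rw [mem_ball_zero_iff, ← Complex.ofReal_sub, Complex.norm_real, ← dist_eq_norm]
        exact hs
      refine ha3 _ hw (fun n ω => ((x ^ n * (transfer φ s)^[n] h ω / h ω : ℝ) : ℂ)) (fun ω => ?_)
        (fun n ω => ?_) n
      · simp [(hh0 ω).ne']
      · simp only [Function.iterate_succ_apply', tilt]
        rw [transfer, ← tsum_mul_left, ← tsum_div_const, Complex.ofReal_tsum]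
        refine tsum_congr fun b => ?_
        have hb := (hh0 (cons b ω)).ne'
        have e1 : Complex.exp (((s : ℂ) - s₀) * φ (cons b ω)) =
            ((Real.exp ((s - s₀) * φ (cons b ω)) : ℝ) : ℂ) := by push_cast; rfl
        rw [e1]
        simp only [hp]
        rw [← Complex.ofReal_mul, ← Complex.ofReal_mul]
        congr 1
        have e2 : Real.exp (s * φ (cons b ω)) =
            Real.exp (s₀ * φ (cons b ω)) * Real.exp ((s - s₀) * φ (cons b ω)) := by
          rw [← Real.exp_add]; ring_nf
        rw [e2, pow_succ]
        have := (hh0 ω).ne'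
        field_simp
  have hlog : AnalyticAt ℝ (fun s => Real.log (x * Real.exp (P s)) - Real.log x) s₀ :=
    (hr.log (by positivity)).sub analyticAt_const
  refine hlog.congr (Eventually.of_forall fun s => ?_)
  simp only
  rw [Real.log_mul hx0.ne' (Real.exp_pos _).ne', Real.log_exp]
  ring

theorem shift2_iterate_apply {E : Type*} (τ : ℤ → E) (j : ℕ) (k : ℤ) :
    shift2^[j] τ k = τ (k + j) := by
  induction j generalizing τ with
  | zero => simp
  | succ j ih =>
    rw [Function.iterate_succ_apply, ih, shift2]
    congr 1
    push_cast
    ring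

/-- Extension of a one-sided sequence to the left by a constant letter. -/
def extZ {E : Type*} (e : E) (ω : ℕ → E) : ℤ → E := fun k => if 0 ≤ k then ω k.toNat else e

theorem extZ_truncZ {E : Type*} (e : E) (τ : ℤ → E) {k : ℤ} (hk : 0 ≤ k) :
    extZ e (truncZ τ) k = τ k := by
  simp [extZ, truncZ, hk]

theorem extZ_natCast {E : Type*} (e : E) (ω : ℕ → E) (k : ℕ) : extZ e ω k = ω k := by
  simp [extZ]

theorem truncZ_extZ {E : Type*} (e : E) (ω : ℕ → E) : truncZ (extZ e ω) = ω :=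
  funext fun k => extZ_natCast e ω k

theorem extZ_congr {E : Type*} (e : E) {ω ω' : ℕ → E} {N : ℕ} (h : Agree N ω ω') {k : ℤ}
    (hk : k < N) : extZ e ω k = extZ e ω' k := by
  by_cases h0 : 0 ≤ k
  · simp only [extZ, h0, if_true]
    exact h _ (by omega)
  · simp [extZ, h0]

theorem truncZ_shift2 {E : Type*} (τ : ℤ → E) : truncZ (shift2 τ) = shift1 (truncZ τ) :=
  funext fun k => by simp [truncZ, shift2, shift1]

/-- A Hölder potential on the two-sided shift is cohomologous, via a bounded transfer function,
to a Hölder potential depending only on the nonnegative coordinates. -/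
theorem HolderShift.exists_onesided {E : Type*} [Nonempty E] {ψ : (ℤ → E) → ℝ}
    (hψ : HolderShift ψ) : ∃ (φ : (ℕ → E) → ℝ) (u : (ℤ → E) → ℝ) (κ V B : ℝ), 0 < κ ∧ κ < 1 ∧
      0 ≤ V ∧ (∀ N ω ω', Agree (N + 1) ω ω' → |φ ω - φ ω'| ≤ V * κ ^ N) ∧ (∀ τ, |u τ| ≤ B) ∧
      ∀ τ, φ (truncZ τ) = ψ τ - u τ + u (shift2 τ) := by
  obtain ⟨e⟩ := ‹Nonempty E›
  obtain ⟨β, hβ, C, hC, hψ⟩ := hψ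
  set κ := Real.exp (-(β / 3)) with hκ
  have hκ0 : 0 < κ := Real.exp_pos _
  have hκ1 : κ < 1 := Real.exp_lt_one_iff.2 (by linarith)
  have hq : ∀ n : ℕ, Real.exp (-β * n) = κ ^ (3 * n) := by
    intro n
    rw [hκ, ← Real.exp_nat_mul]
    push_cast
    ring_nf
  have hψ' : ∀ (n : ℕ) (τ τ' : ℤ → E), (∀ k : ℤ, |k| ≤ (n : ℤ) → τ k = τ' k) →
      |ψ τ - ψ τ'| ≤ C * κ ^ (3 * n) := fun n τ τ' h => by
    rw [← hq]; exact hψ τ τ' n h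
  have hmono : ∀ {m n : ℕ}, m ≤ n → κ ^ n ≤ κ ^ m := fun h =>
    pow_le_pow_of_le_one hκ0.le hκ1.le h
  have hgeo : Summable fun j : ℕ => κ ^ j := summable_geometric_of_lt_one hκ0.le hκ1
  set r : (ℤ → E) → ℕ → ℝ := fun τ j =>
    ψ (shift2^[j] τ) - ψ (shift2^[j] (extZ e (truncZ τ))) with hr
  have hrb : ∀ τ j, ‖r τ j‖ ≤ C * κ ^ j := by
    intro τ j
    refine (hψ' j _ _ fun k hk => ?_).trans ?_
    · rw [shift2_iterate_apply, shift2_iterate_apply, extZ_truncZ]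
      have := (abs_le.1 hk).1
      linarith
    · exact mul_le_mul_of_nonneg_left (hmono (by omega)) hC.le
  have hrs : ∀ τ, Summable (r τ) := fun τ => Summable.of_norm_bounded (hgeo.mul_left C) (hrb τ)
  set u : (ℤ → E) → ℝ := fun τ => ∑' j, r τ j with hu
  set t : (ℕ → E) → ℕ → ℝ := fun ω j => r (shift2 (extZ e ω)) j with ht
  have ht2 : ∀ ω j, t ω j =
      ψ (shift2^[j + 1] (extZ e ω)) - ψ (shift2^[j] (extZ e (shift1 ω))) := by
    intro ω j
    simp only [ht, hr]
    rw [Function.iterate_succ_apply, truncZ_shift2, truncZ_extZ]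
  have htd : ∀ N ω ω', Agree (N + 1) ω ω' → ∀ j,
      ‖t ω j - t ω' j‖ ≤ (2 * C * κ⁻¹ ^ 3 * κ ^ N) * κ ^ j := by
    intro N ω ω' hA j
    have hA' : Agree N (shift1 ω) (shift1 ω') := fun k hk => hA (k + 1) (by omega)
    have e0 : 2 * C * κ⁻¹ ^ 3 * κ ^ N * κ ^ j = 2 * C * κ⁻¹ ^ 3 * κ ^ (N + j) := by
      rw [pow_add]; ring
    have hinv : 1 ≤ κ⁻¹ ^ 3 := one_le_pow₀ ((one_le_inv₀ hκ0).2 hκ1.le)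
    rw [e0]
    rcases le_or_gt N (2 * j) with hj | hj
    · have h1 : 2 * C * κ ^ (3 * j) ≤ 2 * C * κ⁻¹ ^ 3 * κ ^ (N + j) := by
        calc 2 * C * κ ^ (3 * j) ≤ 2 * C * 1 * κ ^ (N + j) := by
              rw [mul_one]; gcongr 2 * C * ?_; exact hmono (by omega)
          _ ≤ _ := by gcongr
      have h2 : ∀ ω, ‖t ω j‖ ≤ C * κ ^ (3 * j) := by
        intro ω
        refine hψ' j _ _ fun k hk => ?_
        rw [shift2_iterate_apply, shift2_iterate_apply, extZ_truncZ]
        have := (abs_le.1 hk).1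
        linarith
      refine (norm_sub_le _ _).trans ?_
      linarith [h2 ω, h2 ω']
    · have h1 : ‖ψ (shift2^[j + 1] (extZ e ω)) - ψ (shift2^[j + 1] (extZ e ω'))‖ ≤
          C * κ ^ (3 * (N - 1 - j)) := by
        refine hψ' _ _ _ fun k hk => ?_
        rw [shift2_iterate_apply, shift2_iterate_apply]
        refine extZ_congr e hA ?_
        have := (abs_le.1 hk).2
        push_cast at *
        omega
      have h2 : ‖ψ (shift2^[j] (extZ e (shift1 ω))) - ψ (shift2^[j] (extZ e (shift1 ω')))‖ ≤
          C * κ ^ (3 * (N - 1 - j)) := by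
        refine hψ' _ _ _ fun k hk => ?_
        rw [shift2_iterate_apply, shift2_iterate_apply]
        refine extZ_congr e hA' ?_
        have := (abs_le.1 hk).2
        omega
      have h3 : κ ^ (3 * (N - 1 - j)) ≤ κ⁻¹ ^ 3 * κ ^ (N + j) := by
        rw [inv_pow, ← div_eq_inv_mul, le_div_iff₀ (by positivity), ← pow_add]
        exact hmono (by omega)
      rw [ht2, ht2, sub_sub_sub_comm]
      refine (norm_sub_le _ _).trans ((add_le_add h1 h2).trans ?_)
      have := mul_le_mul_of_nonneg_left h3 hC.le
      linarith
  have hts : ∀ ω, Summable (t ω) := fun ω => hrs _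
  refine ⟨fun ω => ψ (extZ e ω) + u (shift2 (extZ e ω)), u, κ,
    C + 2 * C * κ⁻¹ ^ 3 * (1 - κ)⁻¹, C * (1 - κ)⁻¹, hκ0, hκ1, ?_, fun N ω ω' hA => ?_,
    fun τ => ?_, fun τ => ?_⟩
  · have : 0 < (1 - κ)⁻¹ := inv_pos.2 (by linarith)
    positivity
  · have h1 : |ψ (extZ e ω) - ψ (extZ e ω')| ≤ C * κ ^ N := by
      refine (hψ' N _ _ fun k hk => extZ_congr e hA ?_).trans ?_
      · have := (abs_le.1 hk).2
        push_cast
        linarith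
      · exact mul_le_mul_of_nonneg_left (hmono (by omega)) hC.le
    have h2 : |u (shift2 (extZ e ω)) - u (shift2 (extZ e ω'))| ≤
        (2 * C * κ⁻¹ ^ 3 * κ ^ N) * (1 - κ)⁻¹ := by
      simp only [hu]
      rw [← (hrs _).tsum_sub (hrs _)]
      refine tsum_of_norm_bounded ?_ (htd N ω ω' hA)
      exact (hasSum_geometric_of_lt_one hκ0.le hκ1).mul_left _
    rw [add_sub_add_comm]
    refine (abs_add_le _ _).trans ((add_le_add h1 h2).trans (le_of_eq ?_))
    ring
  · exact tsum_of_norm_bounded ((hasSum_geometric_of_lt_one hκ0.le hκ1).mul_left C) (hrb τ)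
  · have h1 : u τ = r τ 0 + ∑' j, r τ (j + 1) := (hrs τ).tsum_eq_zero_add
    have hs := (summable_nat_add_iff 1).2 (hrs τ)
    have h2 : u (shift2 τ) - ∑' j, r τ (j + 1) = u (shift2 (extZ e (truncZ τ))) := by
      simp only [hu]
      rw [← (hrs _).tsum_sub hs]
      refine tsum_congr fun j => ?_
      simp only [hr]
      rw [Function.iterate_succ_apply, Function.iterate_succ_apply, truncZ_shift2, truncZ_shift2,
        truncZ_extZ]
      ring
    have h3 : r τ 0 = ψ τ - ψ (extZ e (truncZ τ)) := by simp [hr]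
    simp only
    linarith

/-- Birkhoff sums of a potential on one-sided sequences. -/
def birk1 {E : Type*} (φ : (ℕ → E) → ℝ) (n : ℕ) (ω : ℕ → E) : ℝ :=
  ∑ j ∈ Finset.range n, φ (shift1^[j] ω)

theorem birk1_succ_cons {E : Type*} (φ : (ℕ → E) → ℝ) (n : ℕ) (a : E) (ω : ℕ → E) :
    birk1 φ (n + 1) (cons a ω) = φ (cons a ω) + birk1 φ n ω := by
  have h : shift1 (cons a ω) = ω := rfl
  simp only [birk1]
  rw [Finset.sum_range_succ', add_comm]
  simp [h]

theorem truncZ_shift2_iterate {E : Type*} (τ : ℤ → E) (j : ℕ) :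
    truncZ (shift2^[j] τ) = shift1^[j] (truncZ τ) := by
  induction j with
  | zero => rfl
  | succ j ih => rw [Function.iterate_succ_apply', truncZ_shift2, ih, Function.iterate_succ_apply']

theorem birk1_truncZ {E : Type*} {ψ u : (ℤ → E) → ℝ} {φ : (ℕ → E) → ℝ}
    (h : ∀ τ, φ (truncZ τ) = ψ τ - u τ + u (shift2 τ)) (n : ℕ) (τ : ℤ → E) :
    birk1 φ n (truncZ τ) = birk ψ n τ - u τ + u (shift2^[n] τ) := by
  induction n with
  | zero => simp [birk1, birk]
  | succ n ih =>
    simp only [birk1, birk] at ih ⊢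
    rw [Finset.sum_range_succ, Finset.sum_range_succ, ih, ← truncZ_shift2_iterate, h,
      Function.iterate_succ_apply']
    ring

theorem birk_const_mul {E : Type*} (s : ℝ) (ψ : (ℤ → E) → ℝ) (n : ℕ) (τ : ℤ → E) :
    birk (fun τ => s * ψ τ) n τ = s * birk ψ n τ := by
  simp [birk, Finset.mul_sum]

theorem cyl2_zero {E : Type*} (τ : ℤ → E) : cyl2 τ 0 = univ := by
  ext; simp [cyl2]

theorem preimage_shift2_cyl2 {E : Type*} (e : E) (ω : ℕ → E) (k : ℕ) :
    shift2 ⁻¹' cyl2 (extZ e ω) k = ⋃ a, cyl2 (extZ e (cons a ω)) (k + 1) := by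
  ext τ
  simp only [cyl2, mem_preimage, mem_ofPred_eq, mem_iUnion, extZ_natCast, shift2]
  constructor
  · intro h
    refine ⟨τ 0, fun j hj => ?_⟩
    cases j with
    | zero => rfl
    | succ j => simpa [cons] using h j (by omega)
  · rintro ⟨a, ha⟩ j hj
    simpa [cons] using ha (j + 1) (by omega)

section Cylinders

variable {E : Type*} [MeasurableSpace E] [MeasurableSingletonClass E]

theorem measurableSet_cyl2 (τ : ℤ → E) (n : ℕ) : MeasurableSet (cyl2 τ n) := by
  have h : cyl2 τ n = ⋂ k : ℕ, ⋂ _ : k < n, (fun τ' : ℤ → E => τ' k) ⁻¹' {τ k} := by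
    ext; simp [cyl2]
  rw [h]
  exact MeasurableSet.iInter fun k => MeasurableSet.iInter fun _ =>
    measurable_pi_apply _ (measurableSet_singleton _)

theorem hasSum_measure_cyl2 [Countable E] {μ : Measure (ℤ → E)} [IsProbabilityMeasure μ]
    (hμ : MeasurePreserving shift2 μ μ) (e : E) (ω : ℕ → E) (k : ℕ) :
    HasSum (fun a => (μ (cyl2 (extZ e (cons a ω)) (k + 1))).toReal)
      (μ (cyl2 (extZ e ω) k)).toReal := by
  have h1 := hμ.measure_preimage (measurableSet_cyl2 (extZ e ω) k).nullMeasurableSet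
  rw [preimage_shift2_cyl2, measure_iUnion ?_ fun a => measurableSet_cyl2 _ _] at h1
  · rw [← h1, ENNReal.tsum_toReal_eq fun a => measure_ne_top _ _]
    refine ENNReal.hasSum_toReal ?_
    rw [h1]
    exact measure_ne_top _ _
  · intro a b hab
    refine Set.disjoint_left.2 fun τ ha hb => hab ?_
    have h2 := ha 0 (by omega)
    have h3 := hb 0 (by omega)
    rw [extZ_natCast] at h2 h3
    exact h2.symm.trans h3

/-- The Gibbs property implies summability of the one-sided potential and controls the iterates
of its transfer operator. -/
theorem IsGibbs.transfer_growth [Countable E] [Nonempty E] {ψ u : (ℤ → E) → ℝ}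
    {φ : (ℕ → E) → ℝ} {B s P : ℝ} (hu : ∀ τ, |u τ| ≤ B)
    (hφ : ∀ τ, φ (truncZ τ) = ψ τ - u τ + u (shift2 τ)) {μ : Measure (ℤ → E)}
    [IsProbabilityMeasure μ] (hμ : MeasurePreserving shift2 μ μ)
    (hG : IsGibbs (fun τ => s * ψ τ) P μ) :
    (∃ M : E → ℝ, Summable M ∧ ∀ a ω, Real.exp (s * φ (cons a ω)) ≤ M a) ∧ ∃ c₁ > 0, ∃ c₂, ∀ (n : ℕ) ω,
      c₁ * Real.exp P ^ n ≤ (transfer φ s)^[n] (fun _ => 1) ω ∧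
      (transfer φ s)^[n] (fun _ => 1) ω ≤ c₂ * Real.exp P ^ n := by
  obtain ⟨e⟩ := ‹Nonempty E›
  obtain ⟨C, hC1, hC⟩ := hG
  set m : ℕ → (ℕ → E) → ℝ := fun k ω => (μ (cyl2 (extZ e ω) k)).toReal with hm
  have hB0 : 0 ≤ B := (abs_nonneg _).trans (hu fun _ => e)
  set c := C * Real.exp (|s| * (2 * B)) with hc
  have hc0 : 0 < c := by positivity
  have hc1 : 1 ≤ c := one_le_mul_of_one_le_of_one_le hC1 (Real.one_le_exp (by positivity))
  have hS : ∀ n ω, |s * birk1 φ n ω - s * birk ψ n (extZ e ω)| ≤ |s| * (2 * B) := by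
    intro n ω
    rw [← mul_sub, abs_mul]
    gcongr
    have h1 := birk1_truncZ hφ n (extZ e ω)
    rw [truncZ_extZ] at h1
    rw [h1]
    have h2 := abs_le.1 (hu (extZ e ω))
    have h3 := abs_le.1 (hu (shift2^[n] (extZ e ω)))
    rw [abs_le]
    constructor <;> linarith [h2.1, h2.2, h3.1, h3.2]
  set F : ℕ → (ℕ → E) → ℝ := fun n ω => m n ω * Real.exp (-(s * birk1 φ n ω)) with hF
  have hF0 : ∀ ω, F 0 ω = 1 := by
    intro ω
    simp [hF, hm, cyl2_zero, birk1]
  have hFbd : ∀ n ω, c⁻¹ ≤ Real.exp P ^ n * F n ω ∧ Real.exp P ^ n * F n ω ≤ c := by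
    intro n ω
    rcases Nat.eq_zero_or_pos n with rfl | hn
    · rw [hF0]
      simpa using ⟨inv_le_one_of_one_le₀ hc1, hc1⟩
    · obtain ⟨h1, h2⟩ := hC n hn (extZ e ω)
      rw [birk_const_mul] at h1 h2
      obtain ⟨h3, h4⟩ := abs_le.1 (hS n ω)
      have e1 : Real.exp P ^ n * F n ω =
          m n ω * Real.exp (n * P - s * birk1 φ n ω) := by
        simp only [hF]
        rw [← Real.exp_nat_mul, sub_eq_add_neg, Real.exp_add]
        ring
      rw [e1]
      constructor
      · calc c⁻¹ = C⁻¹ * Real.exp (-(|s| * (2 * B))) := by rw [hc, mul_inv, Real.exp_neg]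
          _ ≤ C⁻¹ * Real.exp (s * birk ψ n (extZ e ω) - s * birk1 φ n ω) := by
            gcongr
            linarith
          _ = (C⁻¹ * Real.exp (s * birk ψ n (extZ e ω) - n * P)) *
              Real.exp (n * P - s * birk1 φ n ω) := by
            rw [mul_assoc, ← Real.exp_add]; ring_nf
          _ ≤ _ := by gcongr
      · calc m n ω * Real.exp (n * P - s * birk1 φ n ω)
            ≤ (C * Real.exp (s * birk ψ n (extZ e ω) - n * P)) *
              Real.exp (n * P - s * birk1 φ n ω) := by gcongr
          _ = C * Real.exp (s * birk ψ n (extZ e ω) - s * birk1 φ n ω) := by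
            rw [mul_assoc, ← Real.exp_add]; ring_nf
          _ ≤ c := by
            rw [hc]
            gcongr
            linarith
  have hm0 : ∀ n ω, 0 ≤ m n ω := fun n ω => ENNReal.toReal_nonneg
  have hFnn : ∀ n ω, 0 ≤ F n ω := fun n ω => mul_nonneg (hm0 n ω) (Real.exp_pos _).le
  have hsum : ∀ n ω, HasSum (fun a => m (n + 1) (cons a ω)) (m n ω) := fun n ω =>
    hasSum_measure_cyl2 hμ e ω n
  have hLF : ∀ n ω, transfer φ s (F (n + 1)) ω = F n ω := by
    intro n ω
    simp only [transfer, hF]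
    rw [← ((hsum n ω).mul_right _).tsum_eq]
    refine tsum_congr fun a => ?_
    rw [birk1_succ_cons, mul_left_comm, ← Real.exp_add]
    ring_nf
  set o : ℕ → E := fun _ => e
  set M : E → ℝ := fun a => c * Real.exp P * m 1 (cons a o) with hM
  have hMs : Summable M := (hsum 0 o).summable.mul_left _
  have hPn : ∀ n : ℕ, 0 < Real.exp P ^ n := fun n => by positivity
  have hφM : ∀ a ω, Real.exp (s * φ (cons a ω)) ≤ M a := by
    intro a ω
    have h1 := (hFbd 1 (cons a ω)).1
    have e1 : m 1 (cons a ω) = m 1 (cons a o) := by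
      simp only [hm]
      congr 2
      ext τ
      simp [cyl2, extZ, cons]
    have e2 : birk1 φ 1 (cons a ω) = φ (cons a ω) := by simp [birk1]
    simp only [hF] at h1
    rw [e1, e2, pow_one, inv_le_iff_one_le_mul₀' hc0, Real.exp_neg, ← div_eq_mul_inv, mul_div_assoc',
      mul_div_assoc', one_le_div (Real.exp_pos _)] at h1
    rw [hM]
    linarith
  have key : ∀ k n ω, c⁻¹ * Real.exp P ^ (n + k) * F n ω ≤ (transfer φ s)^[k] (fun _ => 1) ω ∧
      (transfer φ s)^[k] (fun _ => 1) ω ≤ c * Real.exp P ^ (n + k) * F n ω := by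
    intro k
    induction k with
    | zero =>
      intro n ω
      obtain ⟨h1, h2⟩ := hFbd n ω
      simp only [add_zero, Function.iterate_zero, id]
      constructor
      · rw [mul_assoc]
        exact (inv_mul_le_one₀ hc0).2 h2
      · rw [mul_assoc]
        exact (inv_le_iff_one_le_mul₀' hc0).1 h1
    | succ k ih =>
      intro n ω
      have e1 : ∀ d : ℝ, d * Real.exp P ^ (n + (k + 1)) * F n ω =
          transfer φ s (fun ω => d * Real.exp P ^ (n + 1 + k) * F (n + 1) ω) ω := by
        intro d
        rw [transfer_const_mul, hLF, show n + 1 + k = n + (k + 1) by ring]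
      have hb : ∀ ω, c * Real.exp P ^ (n + 1 + k) * F (n + 1) ω ≤ c * Real.exp P ^ k * c := by
        intro ω
        calc c * Real.exp P ^ (n + 1 + k) * F (n + 1) ω
            = c * Real.exp P ^ k * (Real.exp P ^ (n + 1) * F (n + 1) ω) := by ring
          _ ≤ _ := by gcongr; exact (hFbd (n + 1) ω).2
      have h0 : ∀ d : ℝ, 0 ≤ d → ∀ ω, 0 ≤ d * Real.exp P ^ (n + 1 + k) * F (n + 1) ω :=
        fun d hd ω => mul_nonneg (mul_nonneg hd (hPn _).le) (hFnn _ _)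
      simp only [Function.iterate_succ_apply']
      rw [e1, e1]
      have hlow := fun ω => (ih (n + 1) ω).1
      have hup := fun ω => (ih (n + 1) ω).2
      exact ⟨transfer_mono hMs hφM (h0 _ (by positivity)) hlow (fun ω => (hup ω).trans (hb ω)) ω,
        transfer_mono hMs hφM (fun ω => (h0 _ (by positivity) ω).trans (hlow ω)) hup hb ω⟩
  refine ⟨⟨M, hMs, hφM⟩, c⁻¹, by positivity, c, fun n ω => ?_⟩
  have := key n 0 ω
  rwa [hF0, mul_one, mul_one, zero_add] at this

end Cylinders

theorem IsGibbs.exists_le_ratio {E : Type*} [MeasurableSpace E] {ψ : (ℤ → E) → ℝ}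
    {s t Ps Pt : ℝ} {μ ν : Measure (ℤ → E)}
    (hμ : IsGibbs (fun τ => s * ψ τ) Ps μ) (hν : IsGibbs (fun τ => t * ψ τ) Pt ν) :
    ∃ L : ℝ, ∀ n : ℕ, 1 ≤ n → ∀ τ, Real.exp ((t - s) * birk ψ n τ - n * (Pt - Ps) - L) ≤
      (ν (cyl2 τ n)).toReal / (μ (cyl2 τ n)).toReal := by
  obtain ⟨C, hC1, hC⟩ := hμ
  obtain ⟨C', hC1', hC'⟩ := hν
  have hCC : 0 < C' * C := by positivity
  refine ⟨Real.log (C' * C), fun n hn τ => ?_⟩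
  have h1 := (hC' n hn τ).1
  obtain ⟨h0, h2⟩ := hC n hn τ
  rw [birk_const_mul] at h0 h1 h2
  have hpos : 0 < (μ (cyl2 τ n)).toReal := lt_of_lt_of_le (by positivity) h0
  rw [le_div_iff₀ hpos, Real.exp_sub, Real.exp_log hCC]
  calc Real.exp ((t - s) * birk ψ n τ - n * (Pt - Ps)) / (C' * C) * (μ (cyl2 τ n)).toReal
      ≤ Real.exp ((t - s) * birk ψ n τ - n * (Pt - Ps)) / (C' * C) *
        (C * Real.exp (s * birk ψ n τ - n * Ps)) := by gcongr
    _ = C'⁻¹ * (Real.exp ((t - s) * birk ψ n τ - n * (Pt - Ps)) *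
        Real.exp (s * birk ψ n τ - n * Ps)) := by field_simp
    _ = C'⁻¹ * Real.exp (t * birk ψ n τ - n * Pt) := by
      rw [← Real.exp_add]; ring_nf
    _ ≤ _ := h1

section Gibbs

variable {E : Type*} [MeasurableSpace E] [MeasurableSingletonClass E] [Countable E]

theorem HolderShift.measurable {ψ : (ℤ → E) → ℝ} (hψ : HolderShift ψ) : Measurable ψ := by
  rcases isEmpty_or_nonempty E with hE | ⟨⟨e⟩⟩
  · exact measurable_of_empty _
  obtain ⟨β, hβ, C, hC, hψ⟩ := hψ
  set w : (n : ℕ) → (Finset.Icc (-(n : ℤ)) n → E) → ℤ → E := fun n v k =>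
    if h : k ∈ Finset.Icc (-(n : ℤ)) n then v ⟨k, h⟩ else e
  refine measurable_of_tendsto_metrizable
    (f := fun n τ => ψ (w n fun k => τ k)) (fun n => ?_) (tendsto_pi_nhds.2 fun τ => ?_)
  · have hr : Measurable (fun (τ : ℤ → E) (k : Finset.Icc (-(n : ℤ)) n) => τ k) :=
      measurable_pi_lambda _ fun k => measurable_pi_apply (k : ℤ)
    exact (Measurable.of_discrete
      (f := fun v : (Finset.Icc (-(n : ℤ)) n → E) => ψ (w n v))).comp hr
  · rw [tendsto_iff_dist_tendsto_zero]
    have h0 : Tendsto (fun n : ℕ => C * Real.exp (-β * n)) atTop (𝓝 0) := by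
      have h1 := (tendsto_pow_atTop_nhds_zero_of_lt_one (Real.exp_pos (-β)).le
        (Real.exp_lt_one_iff.2 (by linarith))).const_mul C
      rw [mul_zero] at h1
      refine h1.congr fun n => ?_
      rw [← Real.exp_nat_mul, mul_comm (n : ℝ)]
    refine squeeze_zero (fun _ => dist_nonneg) (fun n => ?_) h0
    rw [Real.dist_eq]
    refine hψ _ _ n fun k hk => ?_
    have : k ∈ Finset.Icc (-(n : ℤ)) n := by
      rw [Finset.mem_Icc]; exact abs_le.1 hk
    exact dif_pos this

theorem exists_ratio {μ ν : Measure (ℤ → E)} [IsProbabilityMeasure μ] [IsProbabilityMeasure ν]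
    (n : ℕ) : Integrable (fun τ => (ν (cyl2 τ n)).toReal / (μ (cyl2 τ n)).toReal) μ ∧
      ∫ τ, (ν (cyl2 τ n)).toReal / (μ (cyl2 τ n)).toReal ∂μ ≤ 1 := by
  set wd : (ℤ → E) → Fin n → E := fun τ i => τ (i : ℕ)
  have hwd : Measurable wd := measurable_pi_lambda _ fun i => measurable_pi_apply _
  have hcyl : ∀ τ, cyl2 τ n = wd ⁻¹' {wd τ} := by
    intro τ
    ext τ'
    simp only [cyl2, mem_preimage, mem_singleton_iff, funext_iff, wd, mem_ofPred_eq]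
    exact ⟨fun h i => h i i.2, fun h k hk => h ⟨k, hk⟩⟩
  set ρ : (Fin n → E) → ℝ := fun v => (ν (wd ⁻¹' {v})).toReal / (μ (wd ⁻¹' {v})).toReal
  have hρ0 : ∀ v, 0 ≤ ρ v := fun v => div_nonneg ENNReal.toReal_nonneg ENNReal.toReal_nonneg
  have hρ : Measurable ρ := Measurable.of_discrete
  have heq : (fun τ => (ν (cyl2 τ n)).toReal / (μ (cyl2 τ n)).toReal) = fun τ => ρ (wd τ) := by
    funext τ
    rw [hcyl]
  rw [heq]
  have hle : ∫⁻ τ, ENNReal.ofReal (ρ (wd τ)) ∂μ ≤ 1 := by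
    rw [← lintegral_map (f := fun v => ENNReal.ofReal (ρ v)) hρ.ennreal_ofReal hwd,
      lintegral_countable']
    have hterm : ∀ v, ENNReal.ofReal (ρ v) * (μ.map wd) {v} ≤ (ν.map wd) {v} := by
      intro v
      rw [Measure.map_apply hwd (measurableSet_singleton _),
        Measure.map_apply hwd (measurableSet_singleton _)]
      by_cases h0 : μ (wd ⁻¹' {v}) = 0
      · simp [h0]
      · have h1 : 0 < (μ (wd ⁻¹' {v})).toReal := ENNReal.toReal_pos h0 (measure_ne_top _ _)
        simp only [ρ]
        rw [ENNReal.ofReal_div_of_pos h1, ENNReal.ofReal_toReal (measure_ne_top _ _),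
          ENNReal.ofReal_toReal (measure_ne_top _ _),
          ENNReal.div_mul_cancel h0 (measure_ne_top _ _)]
    calc ∑' v, ENNReal.ofReal (ρ v) * (μ.map wd) {v} ≤ ∑' v, (ν.map wd) {v} :=
          ENNReal.tsum_le_tsum hterm
      _ = (ν.map wd) univ := by
          rw [← measure_iUnion (fun a b hab => Set.disjoint_singleton.2 hab)
            fun v => measurableSet_singleton v, Set.iUnion_of_singleton]
      _ = 1 := by rw [Measure.map_apply hwd MeasurableSet.univ]; simp
  have hm : AEStronglyMeasurable (fun τ => ρ (wd τ)) μ := (hρ.comp hwd).aestronglyMeasurable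
  refine ⟨⟨hm, ?_⟩, ?_⟩
  · rw [hasFiniteIntegral_iff_ofReal (Eventually.of_forall fun τ => hρ0 _)]
    exact hle.trans_lt ENNReal.one_lt_top
  · rw [integral_eq_lintegral_of_nonneg_ae (Eventually.of_forall fun τ => hρ0 _) hm]
    exact ENNReal.toReal_le_of_le_ofReal one_pos.le (by simpa using hle)

theorem IsGibbs.integrable {ψ : (ℤ → E) → ℝ} (hψ : Measurable ψ) (hψ0 : ∀ τ, ψ τ ≤ 0)
    {s t Ps Pt : ℝ} (hts : t < s) {μ ν : Measure (ℤ → E)} [IsProbabilityMeasure μ]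
    [IsProbabilityMeasure ν] (hμ : IsGibbs (fun τ => s * ψ τ) Ps μ)
    (hν : IsGibbs (fun τ => t * ψ τ) Pt ν) : Integrable ψ μ := by
  obtain ⟨L, hL⟩ := hμ.exists_le_ratio hν
  have hst : 0 < s - t := by linarith
  refine ((exists_ratio (μ := μ) (ν := ν) 1).1.const_mul
    ((s - t)⁻¹ * Real.exp (Pt - Ps + L))).mono' hψ.aestronglyMeasurable
    (Eventually.of_forall fun τ => ?_)
  have h1 := hL 1 le_rfl τ
  have h2 : birk ψ 1 τ = ψ τ := by simp [birk]
  rw [h2] at h1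
  have h3 : (t - s) * ψ τ ≤ Real.exp ((t - s) * ψ τ) := by
    linarith [Real.add_one_le_exp ((t - s) * ψ τ)]
  rw [Real.norm_eq_abs, abs_of_nonpos (hψ0 τ)]
  calc -ψ τ = (s - t)⁻¹ * ((t - s) * ψ τ) := by field_simp; ring
    _ ≤ (s - t)⁻¹ * Real.exp ((t - s) * ψ τ) := by gcongr
    _ = (s - t)⁻¹ * Real.exp (Pt - Ps + L) *
        Real.exp ((t - s) * ψ τ - (1 : ℕ) * (Pt - Ps) - L) := by
      rw [mul_assoc, ← Real.exp_add]; push_cast; ring_nf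
    _ ≤ _ := by gcongr

/-- The pressure function lies above its supporting lines. -/
theorem IsGibbs.pressure_ge {ψ : (ℤ → E) → ℝ} {s t Ps Pt : ℝ} {μ ν : Measure (ℤ → E)}
    [IsProbabilityMeasure μ] [IsProbabilityMeasure ν] (hψ : Integrable ψ μ)
    (hinv : MeasurePreserving shift2 μ μ) (hμ : IsGibbs (fun τ => s * ψ τ) Ps μ)
    (hν : IsGibbs (fun τ => t * ψ τ) Pt ν) : Ps + (t - s) * ∫ τ, ψ τ ∂μ ≤ Pt := by
  obtain ⟨L, hL⟩ := hμ.exists_le_ratio hν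
  have hcomp : ∀ j, Integrable (fun τ => ψ (shift2^[j] τ)) μ := fun j =>
    (hinv.iterate j).integrable_comp_of_integrable hψ
  have hintegrable : ∀ j, ∫ τ, ψ (shift2^[j] τ) ∂μ = ∫ τ, ψ τ ∂μ := fun j => by
    have hj := hinv.iterate j
    conv_rhs => rw [← hj.map_eq]
    rw [integral_map hj.measurable.aemeasurable]
    rw [hj.map_eq]
    exact hψ.aestronglyMeasurable
  have hbi : ∀ n, Integrable (birk ψ n) μ := fun n => integrable_finsetSum _ fun j _ => hcomp j
  have hbint : ∀ n : ℕ, ∫ τ, birk ψ n τ ∂μ = n * ∫ τ, ψ τ ∂μ := fun n => by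
    simp only [birk]
    rw [integral_finsetSum _ fun j _ => hcomp j]
    simp [hintegrable]
  set d := (t - s) * ∫ τ, ψ τ ∂μ - (Pt - Ps) with hd
  have hn : ∀ n : ℕ, 1 ≤ n → n * d ≤ L := by
    intro n hn
    obtain ⟨h1, h2⟩ := exists_ratio (μ := μ) (ν := ν) n
    have h3 : Integrable (fun τ => (t - s) * birk ψ n τ - (n * (Pt - Ps) + L)) μ :=
      ((hbi n).const_mul _).sub (integrable_const _)
    have h4 := integral_mono h3 (h1.sub (integrable_const 1)) fun τ => by
      have e1 := hL n hn τ
      have e2 := Real.add_one_le_exp ((t - s) * birk ψ n τ - n * (Pt - Ps) - L)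
      simp only [Pi.sub_apply]
      linarith
    simp only [Pi.sub_apply] at h4
    rw [integral_sub ((hbi n).const_mul _) (integrable_const _), integral_const_mul, hbint,
      integral_sub h1 (integrable_const _)] at h4
    simp only [integral_const, probReal_univ, one_smul] at h4
    rw [hd]
    linarith
  by_contra! hcon
  have hd0 : 0 < d := by rw [hd]; linarith
  obtain ⟨n, hn'⟩ := exists_nat_gt (L / d)
  rw [div_lt_iff₀ hd0] at hn'
  have h5 := hn (n + 1) (by omega)
  push_cast at h5
  linarith

end Gibbs

/-- A function on an open set lying above a supporting line at every point is continuous. -/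
theorem continuousAt_of_supporting_lines {P I : ℝ → ℝ} {J : Set ℝ} (hJ : IsOpen J)
    (h : ∀ s ∈ J, ∀ t ∈ J, P s + (t - s) * I s ≤ P t) {s : ℝ} (hs : s ∈ J) : ContinuousAt P s := by
  obtain ⟨ε, hε, hball⟩ := Metric.isOpen_iff.1 hJ s hs
  have hmem : ∀ t, |t - s| < ε → t ∈ J := fun t ht => hball (by rwa [mem_ball, Real.dist_eq])
  have hmono : ∀ a ∈ J, ∀ b ∈ J, a < b → I a ≤ I b := by
    intro a ha b hb hab
    have h1 := h a ha b hb
    have h2 := h b hb a ha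
    nlinarith
  set η := ε / 2
  have hη : 0 < η := by positivity
  have hηε : η < ε := half_lt_self hε
  have ha : s - η ∈ J := hmem _ (by rw [abs_of_neg] <;> linarith)
  have hb : s + η ∈ J := hmem _ (by rw [abs_of_pos] <;> linarith)
  set B := |I (s - η)| + |I (s + η)| with hB
  have hIB : ∀ t, |t - s| < η → |I t| ≤ B := by
    intro t ht
    have ht' := abs_lt.1 ht
    have hm := hmem t (ht.trans hηε)
    have h1 := hmono _ ha t hm (by linarith)
    have h2 := hmono t hm _ hb (by linarith)
    rw [abs_le]
    constructor
    · linarith [neg_abs_le (I (s - η)), abs_nonneg (I (s + η))]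
    · linarith [le_abs_self (I (s + η)), abs_nonneg (I (s - η))]
  have hPB : ∀ t, |t - s| < η → |P t - P s| ≤ B * |t - s| := by
    intro t ht
    have hm := hmem t (ht.trans hηε)
    have h1 := h s hs t hm
    have h2 := h t hm s hs
    have h3 : |(t - s) * I s| ≤ B * |t - s| := by
      rw [abs_mul, mul_comm]
      gcongr
      exact hIB s (by simpa using hη)
    have h4 : |(s - t) * I t| ≤ B * |t - s| := by
      rw [abs_mul, mul_comm, abs_sub_comm s t]
      gcongr
      exact hIB t ht
    rw [abs_le]
    constructor
    · linarith [(abs_le.1 h3).1]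
    · linarith [(abs_le.1 h4).1]
  rw [ContinuousAt, tendsto_iff_dist_tendsto_zero]
  have hlim : Tendsto (fun t => B * |t - s|) (𝓝 s) (𝓝 0) := by
    have : Continuous fun t => B * |t - s| := by fun_prop
    simpa using this.tendsto s
  refine squeeze_zero' (Eventually.of_forall fun _ => dist_nonneg) ?_ hlim
  filter_upwards [ball_mem_nhds s hη] with t ht
  rw [Real.dist_eq]
  exact hPB t (by rwa [mem_ball, Real.dist_eq] at ht)

/-- Analyticity of the pressure of a Hölder potential along a family of Gibbs measures. -/
theorem analyticAt_pressure {E : Type*} [MeasurableSpace E] [MeasurableSingletonClass E]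
    [Countable E] [Nonempty E] {ψ : (ℤ → E) → ℝ} (hψ : HolderShift ψ) {J : Set ℝ} (hJ : IsOpen J)
    {μ : ℝ → Measure (ℤ → E)} {P : ℝ → ℝ} (hμ : ∀ s ∈ J, IsProbabilityMeasure (μ s))
    (hinv : ∀ s ∈ J, MeasurePreserving shift2 (μ s) (μ s))
    (hG : ∀ s ∈ J, IsGibbs (fun τ => s * ψ τ) (P s) (μ s)) {s : ℝ} (hs : s ∈ J)
    (hP : ContinuousAt P s) : AnalyticAt ℝ P s := by
  obtain ⟨φ, u, κ, V, B, hκ0, hκ1, hV0, hV, hu, hφ⟩ := hψ.exists_onesided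
  obtain ⟨ε, hε, hball⟩ := Metric.isOpen_iff.1 hJ s hs
  have hgr := fun t (ht : t ∈ J) =>
    have := hμ t ht
    IsGibbs.transfer_growth hu hφ (hinv t ht) (hG t ht)
  have hp : s + ε / 2 ∈ J := hball (by
    rw [mem_ball, Real.dist_eq, add_sub_cancel_left, abs_of_pos] <;> linarith)
  have hm : s - ε / 2 ∈ J := hball (by
    rw [mem_ball, Real.dist_eq, sub_sub_cancel_left, abs_of_neg] <;> linarith)
  obtain ⟨M₁, hM₁, hM₁'⟩ := (hgr _ hp).1
  obtain ⟨M₂, hM₂, hM₂'⟩ := (hgr _ hm).1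
  refine analyticAt_of_transfer_growth hκ0 hκ1 hV0 hV (half_pos hε) (hM₁.add hM₂)
    (fun a ω => ?_) hP fun t ht => (hgr t (hball (ball_subset_ball (by linarith) ht))).2
  have h1 := hM₁' a ω
  have h2 := hM₂' a ω
  set x := φ (cons a ω)
  rw [← Real.exp_add]
  rcases abs_cases x with ⟨hx, -⟩ | ⟨hx, -⟩
  · rw [hx, ← add_mul]
    linarith [Real.exp_pos ((s - ε / 2) * x)]
  · rw [hx, mul_neg, ← sub_eq_add_neg, ← sub_mul]
    linarith [Real.exp_pos ((s + ε / 2) * x)]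

section Skew

variable {E : Type*} [MeasurableSpace E]

theorem SmaleSkew.mapsTo_Titer (S : SmaleSkew E) (τ : ℤ → E) (n : ℕ) :
    MapsTo (Titer S.T τ n) S.Y S.Y := by
  induction n with
  | zero => exact mapsTo_id _
  | succ n ih => exact ih.comp (S.hTY _)

theorem SmaleSkew.pi2_mem (S : SmaleSkew E) (τ : ℤ → E) : S.pi2 τ ∈ S.Ystar := by
  refine S.hYYstar ?_
  have h := closure_mono (S.mapsTo_Titer τ 1).image_subset (S.hpi2 τ 1 le_rfl)
  rwa [S.hYU, closure_closure, ← S.hYU] at h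

theorem SmaleSkew.log_norm_fderiv_le (S : SmaleSkew E) (τ : ℤ → E) :
    Real.log ‖fderiv ℝ (S.T (truncZ τ)) (S.pi2 τ)‖ ≤ -Real.log S.lam := by
  have hmem := S.pi2_mem τ
  have hl : 0 < S.lam := by linarith [S.hlam]
  have hle : ‖fderiv ℝ (S.T (truncZ τ)) (S.pi2 τ)‖ ≤ S.lam⁻¹ := by
    refine norm_fderiv_le_of_lip' ℝ (inv_nonneg.2 hl.le) ?_
    filter_upwards [S.hYstar_open.mem_nhds hmem] with y hy
    simpa [dist_eq_norm] using S.hcontr (truncZ τ) y hy _ hmem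
  have hpos : 0 < ‖fderiv ℝ (S.T (truncZ τ)) (S.pi2 τ)‖ :=
    norm_pos_iff.2 (S.hTconf (truncZ τ) _ hmem).ne_zero
  rw [← Real.log_inv]
  exact Real.log_le_log hpos hle

end Skew

/-- For a conformal Smale skew-product `T` over `I = ℕ* × ℕ*`, with
`μ_{T,s}` the equilibrium measure (unique ergodic shift-invariant Gibbs state) of the
geometric potential `ψ_{T,s}` for each `s ∈ F(T)`, the function
`s ↦ δ_{T,s} = (P(ψ_{T,s}) + s χ_T(μ_{T,s}))/χ_T(μ_{T,s})` is real-analytic on the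
interior of the interval `F(T)`. -/
theorem stmt3 (S : SmaleSkew Ialph)
    (μ : ℝ → Measure (ℤ → Ialph)) (P : ℝ → ℝ)
    (hμ : ∀ s ∈ FT S, IsProbabilityMeasure (μ s) ∧ Ergodic shift2 (μ s) ∧
      IsGibbs (geomPot S s) (P s) (μ s) ∧
      Tendsto (pressureSeq (geomPot S s)) atTop (𝓝 (P s))) :
    AnalyticOnNhd ℝ (fun s : ℝ => (P s + s * lyap S (μ s)) / lyap S (μ s))
      (interior (FT S)) := by
  set ψ : (ℤ → Ialph) → ℝ := fun τ => Real.log ‖fderiv ℝ (S.T (truncZ τ)) (S.pi2 τ)‖ with hψdef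
  have hψ : HolderShift ψ := S.hHolder
  have hl : 0 < Real.log S.lam := Real.log_pos S.hlam
  have hψle : ∀ τ, ψ τ ≤ -Real.log S.lam := S.log_norm_fderiv_le
  set J := interior (FT S)
  have hJ : IsOpen J := isOpen_interior
  have hJF : ∀ s ∈ J, s ∈ FT S := fun s hs => interior_subset hs
  have hprob : ∀ s ∈ J, IsProbabilityMeasure (μ s) := fun s hs => (hμ s (hJF s hs)).1
  have hinv : ∀ s ∈ J, MeasurePreserving shift2 (μ s) (μ s) :=
    fun s hs => (hμ s (hJF s hs)).2.1.toMeasurePreserving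
  have hG : ∀ s ∈ J, IsGibbs (fun τ => s * ψ τ) (P s) (μ s) :=
    fun s hs => (hμ s (hJF s hs)).2.2.1
  have hintegrable : ∀ s ∈ J, Integrable ψ (μ s) := by
    intro s hs
    obtain ⟨ε, hε, hsub⟩ := Metric.isOpen_iff.1 hJ s hs
    have ht : s - ε / 2 ∈ J := by
      refine hsub ?_
      rw [mem_ball, Real.dist_eq, abs_lt]
      constructor <;> linarith
    have := hprob s hs
    have := hprob _ ht
    exact IsGibbs.integrable hψ.measurable (fun τ => by linarith [hψle τ])
      (by linarith : s - ε / 2 < s) (hG s hs) (hG _ ht)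
  have hsupp : ∀ s ∈ J, ∀ t ∈ J, P s + (t - s) * ∫ τ, ψ τ ∂(μ s) ≤ P t := by
    intro s hs t ht
    have := hprob s hs
    have := hprob t ht
    exact IsGibbs.pressure_ge (hintegrable s hs) (hinv s hs) (hG s hs) (hG t ht)
  have hana : ∀ s ∈ J, AnalyticAt ℝ P s := fun s hs =>
    analyticAt_pressure hψ hJ hprob hinv hG hs (continuousAt_of_supporting_lines hJ hsupp hs)
  have hderiv : ∀ s ∈ J, lyap S (μ s) = -deriv P s := by
    intro s hs
    have h1 : HasDerivAt (fun t => P t - (t - s) * ∫ τ, ψ τ ∂(μ s))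
        (deriv P s - 1 * ∫ τ, ψ τ ∂(μ s)) s :=
      (hana s hs).differentiableAt.hasDerivAt.sub
        (((hasDerivAt_id s).sub_const s).mul_const _)
    have h2 : IsLocalMin (fun t => P t - (t - s) * ∫ τ, ψ τ ∂(μ s)) s := by
      filter_upwards [hJ.mem_nhds hs] with t ht
      have := hsupp s hs t ht
      simp only [sub_self, zero_mul, sub_zero]
      linarith
    have h3 := h2.hasDerivAt_eq_zero h1
    have h4 : lyap S (μ s) = -∫ τ, ψ τ ∂(μ s) := rfl
    rw [h4]
    linarith
  have hpos : ∀ s ∈ J, 0 < lyap S (μ s) := by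
    intro s hs
    have := hprob s hs
    have h1 : ∫ τ, ψ τ ∂(μ s) ≤ ∫ _, -Real.log S.lam ∂(μ s) :=
      integral_mono (hintegrable s hs) (integrable_const _) hψle
    have h4 : lyap S (μ s) = -∫ τ, ψ τ ∂(μ s) := rfl
    simp only [integral_const, probReal_univ, one_smul] at h1
    rw [h4]
    linarith
  intro s hs
  have hd : AnalyticAt ℝ (fun t => -deriv P t) s := (hana s hs).deriv.neg
  have hne : -deriv P s ≠ 0 := by
    rw [← hderiv s hs]
    exact (hpos s hs).ne'
  refine (((hana s hs).add (analyticAt_id.mul hd)).div hd hne).congr ?_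
  filter_upwards [hJ.mem_nhds hs] with t ht
  simp [hderiv t ht]

end
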